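/- If H1 is a super right nebula and H2 is a CL-Δgalaxy, then there exists ε > 0 such that every {H1,H2}-free tournament T contains a transitive subtournament of size at least |T|^ε. -/

import Mathlib

open Finset

/-- A tournament on vertex set `Fin n`: `adj u v` means there is an arc from `u` to `v`. -/
structure Tournament (n : ℕ) where
  adj : Fin n → Fin n → Prop
  asymm : ∀ u v, adj u v → ¬ adj v u
  total : ∀ u v, u ≠ v → adj u v ∨ adj v u

namespace Tournament

variable {n N : ℕ}

/-- The position of vertex `v` in the ordering `θ`, where `θ k` is the `k`-th vertex. -/
def pos (θ : Equiv.Perm (Fin n)) (v : Fin n) : Fin n := θ.symm v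

/-- The arc `u → v` of `T` is a backward arc under the ordering `θ`. -/
def Backward (T : Tournament n) (θ : Equiv.Perm (Fin n)) (u v : Fin n) : Prop :=
  T.adj u v ∧ pos θ v < pos θ u

/-- `x` lies strictly between two elements of `L` under the ordering `θ`. -/
def BetweenSet (θ : Equiv.Perm (Fin n)) (L : Finset (Fin n)) (x : Fin n) : Prop :=
  ∃ u ∈ L, ∃ w ∈ L, pos θ u < pos θ x ∧ pos θ x < pos θ w

/-- The induced subtournament of `T` on `s` is transitive. -/
def IsTransOn (T : Tournament n) (s : Finset (Fin n)) : Prop :=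
  ∀ u ∈ s, ∀ v ∈ s, ∀ w ∈ s, T.adj u v → T.adj v w → T.adj u w

/-- The largest size of a transitive subtournament of `T` contained in `s`. -/
noncomputable def trSizeOn (T : Tournament n) (s : Finset (Fin n)) : ℕ :=
  sSup {k | ∃ t, t ⊆ s ∧ T.IsTransOn t ∧ t.card = k}

/-- `tr(T)`: the largest size of a transitive subtournament of `T`. -/
noncomputable def trSize (T : Tournament n) : ℕ := T.trSizeOn Finset.univ

/-- `T` contains `H`: some induced subtournament of `T` is isomorphic to `H`. -/
def Contains (T : Tournament N) (H : Tournament n) : Prop :=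
  ∃ f : Fin n ↪ Fin N, ∀ u v, H.adj u v ↔ T.adj (f u) (f v)

/-- `T` is `ε`-critical. -/
def EpsCritical (T : Tournament n) (ε : ℝ) : Prop :=
  ((T.trSize : ℝ) < (n : ℝ) ^ ε) ∧
  ∀ s : Finset (Fin n), s ≠ Finset.univ → ((s.card : ℝ) ^ ε ≤ (T.trSizeOn s : ℝ))

/-- `S` with center `c` is a right star of `T` under `θ`. -/
def IsRightStarAt (T : Tournament n) (θ : Equiv.Perm (Fin n)) (S : Finset (Fin n))
    (c : Fin n) : Prop :=
  c ∈ S ∧ (S.erase c).Nonempty ∧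
  (∀ v ∈ S.erase c, pos θ v < pos θ c ∧ T.adj c v) ∧
  (∀ u ∈ S, ∀ v ∈ S, T.Backward θ u v → u = c)

/-- `S` with center `c` is a left star of `T` under `θ`. -/
def IsLeftStarAt (T : Tournament n) (θ : Equiv.Perm (Fin n)) (S : Finset (Fin n))
    (c : Fin n) : Prop :=
  c ∈ S ∧ (S.erase c).Nonempty ∧
  (∀ v ∈ S.erase c, pos θ c < pos θ v ∧ T.adj v c) ∧
  (∀ u ∈ S, ∀ v ∈ S, T.Backward θ u v → v = c)

/-- `S` with center `c` is a middle star of `T` under `θ`. -/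
def IsMiddleStarAt (T : Tournament n) (θ : Equiv.Perm (Fin n)) (S : Finset (Fin n))
    (c : Fin n) : Prop :=
  c ∈ S ∧
  (∃ v ∈ S.erase c, pos θ v < pos θ c) ∧ (∃ v ∈ S.erase c, pos θ c < pos θ v) ∧
  (∀ v ∈ S.erase c, (pos θ v < pos θ c → T.adj c v) ∧ (pos θ c < pos θ v → T.adj v c)) ∧
  (∀ u ∈ S, ∀ v ∈ S, T.Backward θ u v → u = c ∨ v = c)

def IsFrontierStarAt (T : Tournament n) (θ : Equiv.Perm (Fin n)) (S : Finset (Fin n))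
    (c : Fin n) : Prop :=
  T.IsLeftStarAt θ S c ∨ T.IsRightStarAt θ S c

def IsStarAt (T : Tournament n) (θ : Equiv.Perm (Fin n)) (S : Finset (Fin n))
    (c : Fin n) : Prop :=
  T.IsLeftStarAt θ S c ∨ T.IsRightStarAt θ S c ∨ T.IsMiddleStarAt θ S c

/-- A middle star with exactly one leaf after the center (center is `u_{p-1}`). -/
def IsOneRightMiddleStarAt (T : Tournament n) (θ : Equiv.Perm (Fin n)) (S : Finset (Fin n))
    (c : Fin n) : Prop :=
  T.IsMiddleStarAt θ S c ∧ ((S.erase c).filter (fun v => pos θ c < pos θ v)).card = 1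

/-- A middle star with exactly one leaf before the center (center is `u_2`). -/
def IsOneLeftMiddleStarAt (T : Tournament n) (θ : Equiv.Perm (Fin n)) (S : Finset (Fin n))
    (c : Fin n) : Prop :=
  T.IsMiddleStarAt θ S c ∧ ((S.erase c).filter (fun v => pos θ v < pos θ c)).card = 1

/-- Kinds of super 2-nebulas. -/
inductive NebKind
  | left
  | middle
  | right

/-- Common requirements on the data of a super 2-nebula: vertex set `S`, centers `c₁, c₂`
(`c₁` before `c₂` under `θ`), leaves `L₁` incident to `c₁` and `L₂` incident to `c₂`. -/
def Super2NebCommon (θ : Equiv.Perm (Fin n)) (S : Finset (Fin n)) (c₁ c₂ : Fin n)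
    (L₁ L₂ : Finset (Fin n)) : Prop :=
  L₁.Nonempty ∧ L₂.Nonempty ∧ Disjoint L₁ L₂ ∧
  c₁ ∉ L₁ ∪ L₂ ∧ c₂ ∉ L₁ ∪ L₂ ∧ c₁ ≠ c₂ ∧
  S = insert c₁ (insert c₂ (L₁ ∪ L₂)) ∧ pos θ c₁ < pos θ c₂

/-- `S` is a super (left/middle/right) 2-nebula of `T` under `θ`, with centers `c₁, c₂` and
leaves `L₁` (incident to `c₁`) and `L₂` (incident to `c₂`). -/
def IsSuper2NebulaAt (T : Tournament n) (θ : Equiv.Perm (Fin n)) (S : Finset (Fin n))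
    (c₁ c₂ : Fin n) (L₁ L₂ : Finset (Fin n)) : NebKind → Prop
  | NebKind.middle =>
      Super2NebCommon θ S c₁ c₂ L₁ L₂ ∧
      (∀ v ∈ L₁ ∪ L₂, pos θ c₁ < pos θ v ∧ pos θ v < pos θ c₂) ∧
      (∀ v ∈ L₁, T.adj v c₁) ∧ (∀ v ∈ L₂, T.adj c₂ v) ∧ T.adj c₂ c₁ ∧
      (∀ u ∈ S, ∀ v ∈ S, T.Backward θ u v →
        (u ∈ L₁ ∧ v = c₁) ∨ (u = c₂ ∧ v ∈ L₂) ∨ (u = c₂ ∧ v = c₁))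
  | NebKind.left =>
      Super2NebCommon θ S c₁ c₂ L₁ L₂ ∧
      (∀ v ∈ L₁ ∪ L₂, pos θ v < pos θ c₁) ∧
      (∀ v ∈ L₁, T.adj c₁ v) ∧ (∀ v ∈ L₂, T.adj c₂ v) ∧ T.adj c₂ c₁ ∧
      (∀ u ∈ S, ∀ v ∈ S, T.Backward θ u v →
        (u = c₁ ∧ v ∈ L₁) ∨ (u = c₂ ∧ v ∈ L₂) ∨ (u = c₂ ∧ v = c₁))
  | NebKind.right =>
      Super2NebCommon θ S c₁ c₂ L₁ L₂ ∧
      (∀ v ∈ L₁ ∪ L₂, pos θ c₂ < pos θ v) ∧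
      (∀ v ∈ L₁, T.adj v c₁) ∧ (∀ v ∈ L₂, T.adj v c₂) ∧ T.adj c₂ c₁ ∧
      (∀ u ∈ S, ∀ v ∈ S, T.Backward θ u v →
        (u ∈ L₁ ∧ v = c₁) ∨ (u ∈ L₂ ∧ v = c₂) ∨ (u = c₂ ∧ v = c₁))

/-- A decomposition of `T` witnessing that `T` is a super nebula under `θ`, with stars
`Q i` (centers `ctr i`) and super 2-nebulas `Sig i` (centers `c₁ i, c₂ i`, leaves
`L₁ i, L₂ i`, of kind `kd i`). -/
def SuperNebulaDecomp (T : Tournament n) (θ : Equiv.Perm (Fin n)) {m l : ℕ}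
    (Q : Fin m → Finset (Fin n)) (ctr : Fin m → Fin n)
    (Sig : Fin l → Finset (Fin n)) (c₁ c₂ : Fin l → Fin n)
    (L₁ L₂ : Fin l → Finset (Fin n)) (kd : Fin l → NebKind) : Prop :=
  (∀ i, T.IsStarAt θ (Q i) (ctr i)) ∧
  (∀ i, T.IsSuper2NebulaAt θ (Sig i) (c₁ i) (c₂ i) (L₁ i) (L₂ i) (kd i)) ∧
  (∀ i j, i ≠ j → Disjoint (Q i) (Q j)) ∧
  (∀ i j, i ≠ j → Disjoint (Sig i) (Sig j)) ∧
  (∀ i j, Disjoint (Q i) (Sig j)) ∧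
  (∀ u v, T.Backward θ u v → (∃ i, u ∈ Q i ∧ v ∈ Q i) ∨ (∃ i, u ∈ Sig i ∧ v ∈ Sig i)) ∧
  (∀ i j, ¬ BetweenSet θ (L₁ j ∪ L₂ j) (ctr i)) ∧
  (∀ i j, i ≠ j → ¬ BetweenSet θ (L₁ j ∪ L₂ j) (c₁ i) ∧ ¬ BetweenSet θ (L₁ j ∪ L₂ j) (c₂ i))

/-- `T` is a super nebula. -/
def IsSuperNebula (T : Tournament n) : Prop :=
  ∃ (θ : Equiv.Perm (Fin n)) (m l : ℕ) (Q : Fin m → Finset (Fin n)) (ctr : Fin m → Fin n)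
    (Sig : Fin l → Finset (Fin n)) (c₁ c₂ : Fin l → Fin n)
    (L₁ L₂ : Fin l → Finset (Fin n)) (kd : Fin l → NebKind),
    SuperNebulaDecomp T θ Q ctr Sig c₁ c₂ L₁ L₂ kd

/-- `{a, b, c}` (in this position order) is a triangle of `T` under `θ`:
`a` is the left exterior, `b` the center, `c` the right exterior. -/
def IsTriangleAt (T : Tournament n) (θ : Equiv.Perm (Fin n)) (a b c : Fin n) : Prop :=
  pos θ a < pos θ b ∧ pos θ b < pos θ c ∧ T.adj b a ∧ T.adj c a ∧ T.adj c b

/-- A decomposition of `T` under `θ` into triangles `{A i, B i, C i}` (left exterior, center,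
right exterior) and frontier stars `Q j` with centers `ctr j`, where for each triangle `i`,
the vertices in `forb i` are not allowed to lie between leaves of a star. -/
def TriGalaxyDecomp (T : Tournament n) (θ : Equiv.Perm (Fin n)) {l k : ℕ}
    (A B C : Fin l → Fin n) (Q : Fin k → Finset (Fin n)) (ctr : Fin k → Fin n)
    (forb : Fin l → Finset (Fin n)) : Prop :=
  (∀ i, T.IsTriangleAt θ (A i) (B i) (C i)) ∧
  (∀ j, T.IsFrontierStarAt θ (Q j) (ctr j)) ∧
  (∀ i j, i ≠ j →
    Disjoint ({A i, B i, C i} : Finset (Fin n)) ({A j, B j, C j} : Finset (Fin n))) ∧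
  (∀ i j, Disjoint ({A i, B i, C i} : Finset (Fin n)) (Q j)) ∧
  (∀ i j, i ≠ j → Disjoint (Q i) (Q j)) ∧
  (∀ u v, T.Backward θ u v →
    (∃ i, u ∈ ({A i, B i, C i} : Finset (Fin n)) ∧ v ∈ ({A i, B i, C i} : Finset (Fin n))) ∨
    (∃ j, u ∈ Q j ∧ v ∈ Q j)) ∧
  (∀ i j, i ≠ j → ¬ BetweenSet θ ((Q j).erase (ctr j)) (ctr i)) ∧
  (∀ i j, ∀ x ∈ forb i, ¬ BetweenSet θ ((Q j).erase (ctr j)) x)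

/-- `T` is a Δgalaxy: a triangular galaxy with exactly one triangle. -/
def IsDeltaGalaxy (T : Tournament n) : Prop :=
  ∃ (θ : Equiv.Perm (Fin n)) (a b c : Fin n) (k : ℕ)
    (Q : Fin k → Finset (Fin n)) (ctr : Fin k → Fin n),
    TriGalaxyDecomp T θ (fun _ : Fin 1 => a) (fun _ => b) (fun _ => c) Q ctr
      (fun _ => ({a, b, c} : Finset (Fin n)))

/-- `T` is a central triangular galaxy: centers of triangles may lie between leaves of stars. -/
def IsCentralTriangularGalaxy (T : Tournament n) : Prop :=
  ∃ (θ : Equiv.Perm (Fin n)) (l k : ℕ) (A B C : Fin l → Fin n)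
    (Q : Fin k → Finset (Fin n)) (ctr : Fin k → Fin n),
    TriGalaxyDecomp T θ A B C Q ctr (fun i => ({A i, C i} : Finset (Fin n)))

/-- `T` is a left triangular galaxy: left exteriors of triangles may lie between leaves. -/
def IsLeftTriangularGalaxy (T : Tournament n) : Prop :=
  ∃ (θ : Equiv.Perm (Fin n)) (l k : ℕ) (A B C : Fin l → Fin n)
    (Q : Fin k → Finset (Fin n)) (ctr : Fin k → Fin n),
    TriGalaxyDecomp T θ A B C Q ctr (fun i => ({B i, C i} : Finset (Fin n)))

/-- `T` is a right triangular galaxy: right exteriors of triangles may lie between leaves. -/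
def IsRightTriangularGalaxy (T : Tournament n) : Prop :=
  ∃ (θ : Equiv.Perm (Fin n)) (l k : ℕ) (A B C : Fin l → Fin n)
    (Q : Fin k → Finset (Fin n)) (ctr : Fin k → Fin n),
    TriGalaxyDecomp T θ A B C Q ctr (fun i => ({A i, B i} : Finset (Fin n)))

/-- A decomposition of `T` witnessing that `T` is a nebula under `θ` (no condition on the
location of the centers of the stars). -/
def NebulaDecomp (T : Tournament n) (θ : Equiv.Perm (Fin n)) {k : ℕ}
    (Q : Fin k → Finset (Fin n)) (ctr : Fin k → Fin n) : Prop :=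
  (∀ i, T.IsStarAt θ (Q i) (ctr i)) ∧
  (∀ i j, i ≠ j → Disjoint (Q i) (Q j)) ∧
  (∀ u v, T.Backward θ u v → ∃ i, u ∈ Q i ∧ v ∈ Q i)

/-- `T` is a central nebula: a nebula all of whose stars are 3-vertex middle stars. -/
def IsCentralNebula (T : Tournament n) : Prop :=
  ∃ (θ : Equiv.Perm (Fin n)) (k : ℕ) (Q : Fin k → Finset (Fin n)) (ctr : Fin k → Fin n),
    NebulaDecomp T θ Q ctr ∧ ∀ i, T.IsMiddleStarAt θ (Q i) (ctr i) ∧ (Q i).card = 3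

/-- `T` is a super left nebula: a nebula all of whose stars are left stars. -/
def IsSuperLeftNebula (T : Tournament n) : Prop :=
  ∃ (θ : Equiv.Perm (Fin n)) (k : ℕ) (Q : Fin k → Finset (Fin n)) (ctr : Fin k → Fin n),
    NebulaDecomp T θ Q ctr ∧ ∀ i, T.IsLeftStarAt θ (Q i) (ctr i)

/-- `T` is a super right nebula: a nebula all of whose stars are right stars. -/
def IsSuperRightNebula (T : Tournament n) : Prop :=
  ∃ (θ : Equiv.Perm (Fin n)) (k : ℕ) (Q : Fin k → Finset (Fin n)) (ctr : Fin k → Fin n),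
    NebulaDecomp T θ Q ctr ∧ ∀ i, T.IsRightStarAt θ (Q i) (ctr i)

/-- `T` is an LR-Δgalaxy: a super Δgalaxy in which only the two exteriors of the triangle
may lie between leaves of a star. -/
def IsLRDeltaGalaxy (T : Tournament n) : Prop :=
  ∃ (θ : Equiv.Perm (Fin n)) (a b c : Fin n) (k : ℕ)
    (Q : Fin k → Finset (Fin n)) (ctr : Fin k → Fin n),
    TriGalaxyDecomp T θ (fun _ : Fin 1 => a) (fun _ => b) (fun _ => c) Q ctr
      (fun _ => ({b} : Finset (Fin n)))

/-- `T` is a CR-Δgalaxy. -/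
def IsCRDeltaGalaxy (T : Tournament n) : Prop :=
  ∃ (θ : Equiv.Perm (Fin n)) (a b c : Fin n) (k : ℕ)
    (Q : Fin k → Finset (Fin n)) (ctr : Fin k → Fin n),
    TriGalaxyDecomp T θ (fun _ : Fin 1 => a) (fun _ => b) (fun _ => c) Q ctr
      (fun _ => ({a} : Finset (Fin n))) ∧
    (∀ i j, i ≠ j → BetweenSet θ ((Q i).erase (ctr i)) b →
      BetweenSet θ ((Q j).erase (ctr j)) c →
      (∀ x ∈ (Q i).erase (ctr i), ¬ BetweenSet θ ((Q j).erase (ctr j)) x) ∧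
      (∀ x ∈ (Q j).erase (ctr j), ¬ BetweenSet θ ((Q i).erase (ctr i)) x)) ∧
    (∀ i, BetweenSet θ ((Q i).erase (ctr i)) b → ¬ BetweenSet θ ((Q i).erase (ctr i)) c)

/-- `T` is a CL-Δgalaxy. -/
def IsCLDeltaGalaxy (T : Tournament n) : Prop :=
  ∃ (θ : Equiv.Perm (Fin n)) (a b c : Fin n) (k : ℕ)
    (Q : Fin k → Finset (Fin n)) (ctr : Fin k → Fin n),
    TriGalaxyDecomp T θ (fun _ : Fin 1 => a) (fun _ => b) (fun _ => c) Q ctr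
      (fun _ => ({c} : Finset (Fin n))) ∧
    (∀ i j, i ≠ j → BetweenSet θ ((Q i).erase (ctr i)) b →
      BetweenSet θ ((Q j).erase (ctr j)) a →
      (∀ x ∈ (Q i).erase (ctr i), ¬ BetweenSet θ ((Q j).erase (ctr j)) x) ∧
      (∀ x ∈ (Q j).erase (ctr j), ¬ BetweenSet θ ((Q i).erase (ctr i)) x)) ∧
    (∀ i, BetweenSet θ ((Q i).erase (ctr i)) b → ¬ BetweenSet θ ((Q i).erase (ctr i)) a)

/-- A decomposition of `T` under `θ` into one super 2-nebula (of kind `kd`) and frontier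
stars, covering all of `V(T)`, witnessing that `T` is a Σ-galaxy under `θ`. -/
def SigmaGalaxyDecomp (T : Tournament n) (θ : Equiv.Perm (Fin n))
    (S : Finset (Fin n)) (c₁ c₂ : Fin n) (L₁ L₂ : Finset (Fin n)) (kd : NebKind)
    {m : ℕ} (Q : Fin m → Finset (Fin n)) (ctr : Fin m → Fin n) : Prop :=
  T.IsSuper2NebulaAt θ S c₁ c₂ L₁ L₂ kd ∧
  (∀ j, T.IsFrontierStarAt θ (Q j) (ctr j)) ∧
  (∀ i j, i ≠ j → Disjoint (Q i) (Q j)) ∧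
  (∀ j, Disjoint S (Q j)) ∧
  (∀ v, v ∈ S ∨ ∃ j, v ∈ Q j) ∧
  (∀ u v, T.Backward θ u v → (u ∈ S ∧ v ∈ S) ∨ ∃ j, u ∈ Q j ∧ v ∈ Q j) ∧
  (∀ j, ¬ BetweenSet θ (L₁ ∪ L₂) (ctr j)) ∧
  (∀ j, ¬ BetweenSet θ ((Q j).erase (ctr j)) c₁ ∧ ¬ BetweenSet θ ((Q j).erase (ctr j)) c₂) ∧
  (∀ i j, i ≠ j → ¬ BetweenSet θ ((Q j).erase (ctr j)) (ctr i))

def IsMiddleSigmaGalaxy (T : Tournament n) : Prop :=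
  ∃ (θ : Equiv.Perm (Fin n)) (S : Finset (Fin n)) (c₁ c₂ : Fin n) (L₁ L₂ : Finset (Fin n))
    (m : ℕ) (Q : Fin m → Finset (Fin n)) (ctr : Fin m → Fin n),
    SigmaGalaxyDecomp T θ S c₁ c₂ L₁ L₂ NebKind.middle Q ctr

def IsLeftSigmaGalaxy (T : Tournament n) : Prop :=
  ∃ (θ : Equiv.Perm (Fin n)) (S : Finset (Fin n)) (c₁ c₂ : Fin n) (L₁ L₂ : Finset (Fin n))
    (m : ℕ) (Q : Fin m → Finset (Fin n)) (ctr : Fin m → Fin n),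
    SigmaGalaxyDecomp T θ S c₁ c₂ L₁ L₂ NebKind.left Q ctr

def IsRightSigmaGalaxy (T : Tournament n) : Prop :=
  ∃ (θ : Equiv.Perm (Fin n)) (S : Finset (Fin n)) (c₁ c₂ : Fin n) (L₁ L₂ : Finset (Fin n))
    (m : ℕ) (Q : Fin m → Finset (Fin n)) (ctr : Fin m → Fin n),
    SigmaGalaxyDecomp T θ S c₁ c₂ L₁ L₂ NebKind.right Q ctr

/-- The directed density from `X` to `Y`. -/
noncomputable def density (T : Tournament n) (X Y : Finset (Fin n)) : ℝ :=
  (Set.ncard {p : Fin n × Fin n | p.1 ∈ X ∧ p.2 ∈ Y ∧ T.adj p.1 p.2} : ℝ) /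
    ((X.card : ℝ) * (Y.card : ℝ))

/-- `(S i)` is a smooth `(c, lam, w)`-structure of `T`. -/
def IsSmoothStructure (T : Tournament n) (c lam : ℝ) {N : ℕ} (w : Fin N → Bool)
    (S : Fin N → Finset (Fin n)) : Prop :=
  (∀ i j, i ≠ j → Disjoint (S i) (S j)) ∧
  (∀ i, w i = false → c * (n : ℝ) ≤ ((S i).card : ℝ)) ∧
  (∀ i, w i = true → T.IsTransOn (S i) ∧ c * (T.trSize : ℝ) ≤ ((S i).card : ℝ)) ∧
  (∀ i j, i < j →
    (∀ v ∈ S i, 1 - lam ≤ T.density {v} (S j)) ∧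
    (∀ v ∈ S j, 1 - lam ≤ T.density (S i) {v}))

end Tournament

/-- The backward arcs of `K₆` under its canonical ordering. -/
def K6back : List (ℕ × ℕ) := [(3, 0), (5, 2), (5, 0), (4, 1)]

/-- The tournament `K₆`, on `Fin 6` with its canonical ordering. -/
def K6 : Tournament 6 where
  adj u v := (u.val, v.val) ∈ K6back ∨ (u < v ∧ (v.val, u.val) ∉ K6back)
  asymm := by decide
  total := by decide

/-- The pair `{H₁, H₂}` satisfies the Erdős–Hajnal conjecture: there is `ε > 0` such that
every `{H₁, H₂}`-free tournament `T` has a transitive subtournament of size `≥ |T| ^ ε`. -/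
def EHPair {n₁ n₂ : ℕ} (H₁ : Tournament n₁) (H₂ : Tournament n₂) : Prop :=
  ∃ ε : ℝ, 0 < ε ∧ ∀ (n : ℕ) (T : Tournament n),
    ¬ T.Contains H₁ → ¬ T.Contains H₂ → (n : ℝ) ^ ε ≤ (T.trSize : ℝ)

open Tournament

namespace Tournament

/-- `f` is a copy of the pattern given by the parent function `p`: the vertices are listed
from last to first, and the only arc into `f i` from a vertex listed before it comes from
`f (p i)`. -/
def IsEmb (T : Tournament n) (p : ℕ → ℕ) {h : ℕ} (f : Fin h → Fin n) : Prop :=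
  ∀ i j : Fin h, j < i →
    ((j : ℕ) = p i → T.adj (f j) (f i)) ∧ ((j : ℕ) ≠ p i → T.adj (f i) (f j))

open Classical in
/-- The copies of the first `h` vertices of the pattern inside `S`. -/
noncomputable def emb (T : Tournament n) (p : ℕ → ℕ) (h : ℕ) (S : Finset (Fin n)) :
    Finset (Fin h → Fin n) :=
  Finset.univ.filter fun f => T.IsEmb p f ∧ ∀ i, f i ∈ S

open Classical in
/-- The arcs from `A` to `B`. -/
noncomputable def arcs (T : Tournament n) (A B : Finset (Fin n)) : Finset (Fin n × Fin n) :=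
  (A ×ˢ B).filter fun e => T.adj e.1 e.2

open Classical in
/-- The out-neighbours of `v` in `B`. -/
noncomputable def outN (T : Tournament n) (v : Fin n) (B : Finset (Fin n)) : Finset (Fin n) :=
  B.filter fun w => T.adj v w

open Classical in
/-- The in-neighbours of `w` in `A`. -/
noncomputable def inN (T : Tournament n) (A : Finset (Fin n)) (w : Fin n) : Finset (Fin n) :=
  A.filter fun v => T.adj v w

open Classical in
/-- The arcs inside `S` that go backward with respect to the rank function `r`. -/
noncomputable def back (T : Tournament n) (r : Fin n → ℕ) (S : Finset (Fin n)) :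
    Finset (Fin n × Fin n) :=
  (S ×ˢ S).filter fun e => r e.2 < r e.1 ∧ T.adj e.1 e.2

/-- Some ordering of `S` has at most `z * |S| ^ 2` backward arcs. -/
def Sparse (T : Tournament n) (z : ℝ) (S : Finset (Fin n)) : Prop :=
  ∃ r : Fin n → ℕ, Set.InjOn r S ∧ ((T.back r S).card : ℝ) ≤ z * (S.card : ℝ) ^ 2

variable {T : Tournament n} {S A B U : Finset (Fin n)} {p : ℕ → ℕ} {h : ℕ} {z : ℝ}

lemma adj_irrefl (T : Tournament n) (v : Fin n) : ¬ T.adj v v := fun hv => T.asymm v v hv hv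

lemma mem_emb {f : Fin h → Fin n} : f ∈ T.emb p h S ↔ T.IsEmb p f ∧ ∀ i, f i ∈ S := by
  simp [emb]

lemma mem_arcs {e : Fin n × Fin n} :
    e ∈ T.arcs A B ↔ (e.1 ∈ A ∧ e.2 ∈ B) ∧ T.adj e.1 e.2 := by
  simp [arcs]

lemma mem_outN {v w : Fin n} : w ∈ T.outN v B ↔ w ∈ B ∧ T.adj v w := by
  simp [outN]

lemma mem_inN {v w : Fin n} : v ∈ T.inN A w ↔ v ∈ A ∧ T.adj v w := by
  simp [inN]

lemma mem_back {r : Fin n → ℕ} {e : Fin n × Fin n} :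
    e ∈ T.back r S ↔ (e.1 ∈ S ∧ e.2 ∈ S) ∧ r e.2 < r e.1 ∧ T.adj e.1 e.2 := by
  simp [back]

lemma emb_mono (hAB : A ⊆ B) : T.emb p h A ⊆ T.emb p h B := fun f hf => by
  rw [mem_emb] at hf ⊢
  exact ⟨hf.1, fun i => hAB (hf.2 i)⟩

lemma outN_mono {v : Fin n} (hAB : A ⊆ B) : T.outN v A ⊆ T.outN v B := fun w hw => by
  rw [mem_outN] at hw ⊢
  exact ⟨hAB hw.1, hw.2⟩

lemma card_arcs_eq_sum_outN : (T.arcs A B).card = ∑ v ∈ A, (T.outN v B).card := by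
  classical
  have := Finset.card_sigma A (fun v => T.outN v B)
  rw [← this]
  refine Finset.card_bij' (fun e _ => ⟨e.1, e.2⟩) (fun e _ => (e.1, e.2)) ?_ ?_ ?_ ?_
  · intro e he
    simp only [mem_arcs] at he
    simp [mem_outN, he]
  · intro e he
    simp only [Finset.mem_sigma, mem_outN] at he
    simp [mem_arcs, he]
  · intros; rfl
  · intros; rfl

lemma card_arcs_eq_sum_inN : (T.arcs A B).card = ∑ w ∈ B, (T.inN A w).card := by
  classical
  have := Finset.card_sigma B (fun w => T.inN A w)
  rw [← this]
  refine Finset.card_bij' (fun e _ => ⟨e.2, e.1⟩) (fun e _ => (e.2, e.1)) ?_ ?_ ?_ ?_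
  · intro e he
    simp only [mem_arcs] at he
    simp [mem_inN, he]
  · intro e he
    simp only [Finset.mem_sigma, mem_inN] at he
    simp [mem_arcs, he]
  · intros; rfl
  · intros; rfl

lemma Sparse.mono {z' : ℝ} (hS : T.Sparse z S) (hz : z ≤ z') : T.Sparse z' S := by
  obtain ⟨r, hr, hb⟩ := hS
  exact ⟨r, hr, hb.trans (by gcongr)⟩

/-- Deleting a suitable vertex keeps a set sparse. -/
lemma exists_erase_back_le {r : Fin n → ℕ} (hS : S.Nonempty)
    (hb : ((T.back r S).card : ℝ) ≤ z * (S.card : ℝ) ^ 2) (hz : 0 ≤ z) :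
    ∃ v ∈ S, ((T.back r (S.erase v)).card : ℝ) ≤ z * ((S.erase v).card : ℝ) ^ 2 := by
  classical
  have key : ∀ v ∈ S, ((T.back r (S.erase v)).card : ℝ) =
      (T.back r S).card - ∑ e ∈ T.back r S, ((if v = e.1 then 1 else 0) +
        (if v = e.2 then 1 else 0) : ℝ) := by
    intro v _
    have h1 : T.back r (S.erase v) = (T.back r S).filter fun e => ¬ (v = e.1 ∨ v = e.2) := by
      ext e
      simp only [mem_back, Finset.mem_erase, Finset.mem_filter]
      constructor
      · rintro ⟨⟨⟨h1, h2⟩, h3, h4⟩, h5⟩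
        exact ⟨⟨⟨h2, h4⟩, h5⟩, by rintro (h | h) <;> simp_all⟩
      · rintro ⟨⟨⟨h2, h4⟩, h5⟩, h6⟩
        push Not at h6
        exact ⟨⟨⟨h6.1.symm, h2⟩, h6.2.symm, h4⟩, h5⟩
    have h2 : ∑ e ∈ T.back r S, ((if v = e.1 then 1 else 0) +
        (if v = e.2 then 1 else 0) : ℝ) =
        ∑ e ∈ T.back r S, (if (v = e.1 ∨ v = e.2) then 1 else 0 : ℝ) := by
      refine Finset.sum_congr rfl fun e he => ?_
      have : e.1 ≠ e.2 := by
        rintro h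
        have := (mem_back.1 he).2.1
        rw [h] at this
        exact lt_irrefl _ this
      by_cases ha : v = e.1
      · have hb : v ≠ e.2 := fun hb => this (ha.symm.trans hb)
        simp [ha, this]
      · simp [ha]
    rw [h1, h2, Finset.sum_boole]
    have := Finset.card_filter_add_card_filter_not (s := T.back r S)
      (fun e => v = e.1 ∨ v = e.2)
    rw [eq_sub_iff_add_eq, add_comm]
    exact_mod_cast this
  have hsum : ∑ v ∈ S, ((T.back r (S.erase v)).card : ℝ) =
      ((S.card : ℝ) - 2) * (T.back r S).card := by
    rw [Finset.sum_congr rfl key, Finset.sum_sub_distrib, Finset.sum_comm]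
    have : ∀ e ∈ T.back r S, ∑ v ∈ S, ((if v = e.1 then 1 else 0) +
        (if v = e.2 then 1 else 0) : ℝ) = 2 := by
      intro e he
      obtain ⟨⟨h1, h2⟩, _⟩ := mem_back.1 he
      rw [Finset.sum_add_distrib, Finset.sum_ite_eq' , Finset.sum_ite_eq']
      simp [h1, h2]
      norm_num
    rw [Finset.sum_congr rfl this]
    simp
    ring
  by_contra! hcon
  have hlt := Finset.sum_lt_sum_of_nonempty hS hcon
  have hm : (1 : ℝ) ≤ S.card := by exact_mod_cast hS.card_pos
  have hc : ∀ v ∈ S, z * ((S.erase v).card : ℝ) ^ 2 = z * ((S.card : ℝ) - 1) ^ 2 := by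
    intro v hv
    rw [Finset.card_erase_of_mem hv, Nat.cast_sub hS.card_pos]
    simp
  rw [Finset.sum_congr rfl hc, hsum, Finset.sum_const, nsmul_eq_mul] at hlt
  rcases eq_or_lt_of_le hm with h1 | h1
  · have h0 : (T.back r S).card = 0 := by
      have hc1 : S.card = 1 := by exact_mod_cast h1.symm
      obtain ⟨a, rfl⟩ := Finset.card_eq_one.1 hc1
      rw [Finset.card_eq_zero, Finset.eq_empty_iff_forall_notMem]
      intro e he
      simp only [mem_back, Finset.mem_singleton] at he
      rw [he.1.1, he.1.2] at he
      exact lt_irrefl _ he.2.1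
    rw [h0, ← h1] at hlt
    simp at hlt
  · have h2 : (2 : ℝ) ≤ S.card := by
      have : 1 < S.card := by exact_mod_cast h1
      exact_mod_cast this
    have := mul_le_mul_of_nonneg_left hb (sub_nonneg.2 h2)
    nlinarith [mul_nonneg hz (by linarith : (0 : ℝ) ≤ S.card)]

lemma exists_subset_back_le {r : Fin n → ℕ} (hz : 0 ≤ z) {k : ℕ} (hk : k ≤ S.card)
    (hb : ((T.back r S).card : ℝ) ≤ z * (S.card : ℝ) ^ 2) :
    ∃ S' ⊆ S, S'.card = k ∧ ((T.back r S').card : ℝ) ≤ z * (k : ℝ) ^ 2 := by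
  induction hm : S.card - k generalizing S with
  | zero =>
    have : S.card = k := by omega
    exact ⟨S, subset_rfl, this, this ▸ hb⟩
  | succ d ih =>
    have hS : S.Nonempty := Finset.card_pos.1 (by omega)
    obtain ⟨v, hv, hv'⟩ := exists_erase_back_le hS hb hz
    have hc := Finset.card_erase_of_mem hv
    obtain ⟨S', h1, h2⟩ := ih (S := S.erase v) (by omega) hv' (by omega)
    exact ⟨S', h1.trans (Finset.erase_subset _ _), h2⟩

lemma Sparse.exists_subset (hS : T.Sparse z S) (hz : 0 ≤ z) {k : ℕ} (hk : k ≤ S.card) :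
    ∃ S' ⊆ S, S'.card = k ∧ T.Sparse z S' := by
  obtain ⟨r, hr, hb⟩ := hS
  obtain ⟨S', h1, h2, h3⟩ := exists_subset_back_le hz hk hb
  exact ⟨S', h1, h2, r, hr.mono (by exact_mod_cast h1), by rw [h2]; exact h3⟩

/-- A set of `s` elements of `S` of largest rank. -/
lemma exists_top {r : Fin n → ℕ} (hr : Set.InjOn r S) {s : ℕ} (hs : s ≤ S.card) :
    ∃ B ⊆ S, B.card = s ∧ ∀ b ∈ B, ∀ a ∈ S, a ∉ B → r a < r b := by
  classical
  induction s with
  | zero => exact ⟨∅, by simp⟩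
  | succ s ih =>
    obtain ⟨B, hB, hc, hB'⟩ := ih (by omega)
    have hne : (S \ B).Nonempty := by
      rw [← Finset.card_pos, Finset.card_sdiff_of_subset hB]
      omega
    obtain ⟨x, hx, hmax⟩ := Finset.exists_max_image (S \ B) r hne
    rw [Finset.mem_sdiff] at hx
    refine ⟨insert x B, Finset.insert_subset hx.1 hB, ?_, ?_⟩
    · rw [Finset.card_insert_of_notMem hx.2, hc]
    · intro b hb a ha hab
      rw [Finset.mem_insert, not_or] at hab
      rcases Finset.mem_insert.1 hb with rfl | hb
      · exact lt_of_le_of_ne (hmax a (by simp [ha, hab.2])) fun h => hab.1 (hr ha hx.1 h)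
      · exact hB' b hb a ha hab.2

/-- Splitting a set into consecutive intervals of equal size. -/
lemma exists_intervals {r : Fin n → ℕ} (hr : Set.InjOn r S) (K s : ℕ) (hs : K * s ≤ S.card) :
    ∃ B : ℕ → Finset (Fin n), (∀ j < K, B j ⊆ S ∧ (B j).card = s) ∧
      ∀ l < K, ∀ j < l, ∀ a ∈ B j, ∀ b ∈ B l, r a < r b := by
  classical
  induction K generalizing S with
  | zero => exact ⟨fun _ => ∅, by simp⟩
  | succ K ih =>
    obtain ⟨A, hA, hc, hA'⟩ := exists_top hr (s := s) (by nlinarith)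
    obtain ⟨B, hB, hB'⟩ := ih (S := S \ A) (hr.mono (by simp))
      (by rw [Finset.card_sdiff_of_subset hA, hc]; apply Nat.le_sub_of_add_le; linarith)
    refine ⟨fun j => if j = K then A else B j, ?_, ?_⟩
    · intro j hj
      by_cases h : j = K
      · simp [h, hA, hc]
      · have := hB j (by omega)
        simp only [h, if_false]
        exact ⟨this.1.trans Finset.sdiff_subset, this.2⟩
    · intro l hl j hj a ha b hb
      have h1 : j ≠ K := by omega
      simp only [h1, if_false] at ha
      by_cases h : l = K
      · simp only [h, if_true] at hb
        have := (hB j (by omega)).1 ha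
        rw [Finset.mem_sdiff] at this
        exact hA' b hb a this.1 this.2
      · simp only [h, if_false] at hb
        exact hB' l (by omega) j hj a ha b hb

/-- Selecting from the blocks one by one, last block first, and deleting after each selection
the few bad vertices of the remaining blocks. -/
lemma exists_peel {α : Type*} {P : Finset α → Prop}
    {Q : Finset α → α → Prop} {m r : ℝ} (hr : 0 ≤ r) (K : ℕ) (B : ℕ → Finset α)
    (hB : ∀ j < K, m + K * r ≤ (B j).card)
    (hsel : ∀ l < K, ∀ U ⊆ B l, m ≤ (U.card : ℝ) → ∃ S' ⊆ U, P S' ∧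
      ∃ R : Finset α, (∀ j < l, ∀ R' ⊆ R, R' ⊆ B j → (R'.card : ℝ) ≤ r) ∧
        ∀ j < l, ∀ w ∈ B j, w ∉ R → Q S' w) :
    ∃ A : ℕ → Finset α, (∀ l < K, A l ⊆ B l ∧ P (A l)) ∧
      ∀ l < K, ∀ j < l, ∀ w ∈ A j, Q (A l) w := by
  classical
  induction K generalizing B with
  | zero => exact ⟨fun _ => ∅, by simp⟩
  | succ K ih =>
    have hK := hB K (by omega)
    push_cast at hB hK
    obtain ⟨S', hS', hP, R, hR, hQ⟩ := hsel K (by omega) (B K) subset_rfl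
      (by nlinarith [mul_nonneg (Nat.cast_nonneg (α := ℝ) K) hr])
    obtain ⟨A, hA, hA'⟩ := ih (fun j => B j \ R) (by
      intro j hj
      have h1 := hR j hj (B j ∩ R) Finset.inter_subset_right Finset.inter_subset_left
      have h2 := hB j (by omega)
      have h3 : ((B j ∩ R).card : ℝ) + (B j \ R).card = (B j).card := by
        exact_mod_cast Finset.card_inter_add_card_sdiff (B j) R
      linarith) (by
      intro l hl U hU hm
      obtain ⟨S'', h1, h2, R'', h3, h4⟩ := hsel l (by omega) U (hU.trans Finset.sdiff_subset) hm
      exact ⟨S'', h1, h2, R'', fun j hj R' hR' hR'' =>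
        h3 j hj R' hR' (hR''.trans Finset.sdiff_subset),
        fun j hj w hw => h4 j hj w (Finset.sdiff_subset hw)⟩)
    refine ⟨fun j => if j = K then S' else A j, ?_, ?_⟩
    · intro l hl
      by_cases h : l = K
      · simp only [h, if_true]
        exact ⟨hS', hP⟩
      · simp only [h, if_false]
        exact ⟨(hA l (by omega)).1.trans Finset.sdiff_subset, (hA l (by omega)).2⟩
    · intro l hl j hj w hw
      have h1 : j ≠ K := by omega
      simp only [h1, if_false] at hw
      by_cases h : l = K
      · simp only [h, if_true]
        have := (hA j (by omega)).1 hw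
        rw [Finset.mem_sdiff] at this
        exact hQ j (by omega) w this.1 this.2
      · simp only [h, if_false]
        exact hA' l (by omega) j hj w hw

/-- Concatenating the orderings of two disjoint sets. -/
lemma exists_rank_union {r₁ r₂ : Fin n → ℕ} (hAB : Disjoint A B) (h₁ : Set.InjOn r₁ A)
    (h₂ : Set.InjOn r₂ B) : ∃ r : Fin n → ℕ, Set.InjOn r ((A ∪ B : Finset (Fin n))) ∧
      (T.back r (A ∪ B)).card ≤ (T.back r₁ A).card + (T.back r₂ B).card + (T.arcs B A).card := by
  classical
  obtain ⟨M, hM⟩ : ∃ M, ∀ v ∈ A, r₁ v < M :=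
    ⟨A.sup r₁ + 1, fun v hv => Nat.lt_succ_of_le (Finset.le_sup hv)⟩
  have hB : ∀ v ∈ A, v ∉ B := fun v hv => Finset.disjoint_left.1 hAB hv
  refine ⟨fun v => if v ∈ B then M + r₂ v else r₁ v, ?_, ?_⟩
  · intro v hv w hw hvw
    simp only [Finset.coe_union, Set.mem_union, Finset.mem_coe] at hv hw
    rcases hv with hv | hv <;> rcases hw with hw | hw
    · simp only [hB v hv, hB w hw, if_false] at hvw
      exact h₁ hv hw hvw
    · simp only [hB v hv, hw, if_false, if_true] at hvw
      have := hM v hv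
      omega
    · simp only [hB w hw, hv, if_false, if_true] at hvw
      have := hM w hw
      omega
    · simp only [hv, hw, if_true] at hvw
      exact h₂ hv hw (by omega)
  · refine (Finset.card_le_card (t := T.back r₁ A ∪ T.back r₂ B ∪ T.arcs B A) ?_).trans
      ((Finset.card_union_le _ _).trans (by gcongr; exact Finset.card_union_le _ _))
    rintro ⟨v, w⟩ he
    obtain ⟨⟨hv, hw⟩, hr, ha⟩ := mem_back.1 he
    simp only [Finset.mem_union, mem_back, mem_arcs] at hv hw ⊢
    simp only at hr ha
    rcases hv with hv | hv <;> rcases hw with hw | hw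
    · simp only [hB v hv, hB w hw, if_false] at hr
      exact Or.inl (Or.inl ⟨⟨hv, hw⟩, hr, ha⟩)
    · simp only [hB v hv, hw, if_false, if_true] at hr
      have := hM v hv
      omega
    · exact Or.inr ⟨⟨hv, hw⟩, ha⟩
    · simp only [hv, hw, if_true] at hr
      exact Or.inl (Or.inr ⟨⟨hv, hw⟩, by omega, ha⟩)

/-- A union of sparse sets with few backward arcs between them is sparse. -/
lemma sparse_biUnion {K s : ℕ} {z₁ τ : ℝ} {A : ℕ → Finset (Fin n)}
    (hd : ∀ l < K, ∀ j < l, Disjoint (A j) (A l)) (hc : ∀ l < K, (A l).card = s)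
    (hs : ∀ l < K, T.Sparse z₁ (A l)) (hτ : 0 ≤ τ)
    (hQ : ∀ l < K, ∀ j < l, ∀ w ∈ A j, ((T.inN (A l) w).card : ℝ) ≤ τ * s)
    (hz : K * z₁ + K ^ 2 * τ ≤ z * K ^ 2) :
    ∃ X : Finset (Fin n), (∀ v ∈ X, ∃ l < K, v ∈ A l) ∧ X.card = K * s ∧ T.Sparse z X := by
  classical
  suffices H : ∀ k ≤ K, ∃ X : Finset (Fin n), (∀ v ∈ X, ∃ l < k, v ∈ A l) ∧ X.card = k * s ∧
      ∃ r : Fin n → ℕ, Set.InjOn r X ∧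
        ((T.back r X).card : ℝ) ≤ (k * z₁ + k ^ 2 * τ) * s ^ 2 by
    obtain ⟨X, h1, h2, r, h3, h4⟩ := H K le_rfl
    refine ⟨X, h1, h2, r, h3, h4.trans ?_⟩
    rw [h2]
    push_cast
    calc (K * z₁ + K ^ 2 * τ) * (s : ℝ) ^ 2 ≤ z * K ^ 2 * (s : ℝ) ^ 2 := by gcongr
      _ = _ := by ring
  intro k hk
  induction k with
  | zero => exact ⟨∅, by simp, by simp, Fin.val, by simp, by simp [back]⟩
  | succ k ih =>
    obtain ⟨X, h1, h2, r, h3, h4⟩ := ih (by omega)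
    obtain ⟨r', h5, h6⟩ := hs k (by omega)
    have hdX : Disjoint X (A k) := by
      rw [Finset.disjoint_left]
      intro v hv
      obtain ⟨l, hl, hvl⟩ := h1 v hv
      exact Finset.disjoint_left.1 (hd k (by omega) l hl) hvl
    obtain ⟨r'', h7, h8⟩ := exists_rank_union (T := T) hdX h3 h5
    refine ⟨X ∪ A k, ?_, ?_, r'', h7, ?_⟩
    · intro v hv
      rcases Finset.mem_union.1 hv with hv | hv
      · obtain ⟨l, hl, hvl⟩ := h1 v hv
        exact ⟨l, by omega, hvl⟩
      · exact ⟨k, by omega, hv⟩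
    · rw [Finset.card_union_of_disjoint hdX, h2, hc k (by omega)]
      ring
    · have h9 : ((T.arcs (A k) X).card : ℝ) ≤ k * s * (τ * s) := by
        rw [card_arcs_eq_sum_inN]
        push_cast
        calc ∑ w ∈ X, ((T.inN (A k) w).card : ℝ) ≤ ∑ w ∈ X, τ * s := by
              refine Finset.sum_le_sum fun w hw => ?_
              obtain ⟨l, hl, hwl⟩ := h1 w hw
              exact hQ k (by omega) l hl w hwl
          _ = k * s * (τ * s) := by rw [Finset.sum_const, nsmul_eq_mul, h2]; push_cast; ring
      rw [hc k (by omega)] at h6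
      have h8' : ((T.back r'' (X ∪ A k)).card : ℝ) ≤ (T.back r X).card + (T.back r' (A k)).card +
        (T.arcs (A k) X).card := by exact_mod_cast h8
      push_cast
      nlinarith [mul_nonneg hτ (sq_nonneg (s : ℝ)),
        mul_nonneg (mul_nonneg hτ (sq_nonneg (s : ℝ))) (Nat.cast_nonneg (α := ℝ) k)]

open Classical in
/-- The vertices of `S` beating all values of `Y`. -/
noncomputable def dominators (T : Tournament n) {k : ℕ} (Y : Fin k → Fin n)
    (S : Finset (Fin n)) : Finset (Fin n) :=
  S.filter fun w => ∀ i, T.adj w (Y i)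

lemma mem_dominators {k : ℕ} {Y : Fin k → Fin n} {w : Fin n} :
    w ∈ T.dominators Y S ↔ w ∈ S ∧ ∀ i, T.adj w (Y i) := by
  simp [dominators]

lemma IsEmb.snoc {k : ℕ} {g : Fin k → Fin n} {w : Fin n} (hg : T.IsEmb p g)
    (hw : ∀ i : Fin k, ((i : ℕ) = p k → T.adj (g i) w) ∧ ((i : ℕ) ≠ p k → T.adj w (g i))) :
    T.IsEmb p (Fin.snoc g w : Fin (k + 1) → Fin n) := by
  intro i j hij
  induction i using Fin.lastCases with
  | last =>
    induction j using Fin.lastCases with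
    | last => exact absurd hij (lt_irrefl _)
    | cast j =>
      simp only [Fin.snoc_castSucc, Fin.snoc_last, Fin.val_castSucc, Fin.val_last]
      exact hw j
  | cast i =>
    induction j using Fin.lastCases with
    | last => exact absurd hij (not_lt.2 (Fin.le_last _))
    | cast j =>
      simp only [Fin.snoc_castSucc, Fin.val_castSucc]
      exact hg i j (by simpa using hij)

/-- Sorting the copies of the first `k + 1` vertices by the position of all vertices except
the parent of the next vertex, and counting the extensions to the next vertex. -/
lemma exists_fibers {k : ℕ} (hp : p (k + 1) < k + 1) (hU : U ⊆ S) :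
    ∃ (F : Finset (Fin k → Fin n)) (A : (Fin k → Fin n) → Finset (Fin n)),
      F.card = U.card ^ k ∧ (∀ Y ∈ F, A Y ⊆ U ∧ ∀ i, Y i ∈ U) ∧
      (T.emb p (k + 1) U).card ≤ ∑ Y ∈ F, (A Y).card ∧
      ∑ Y ∈ F, ∑ v ∈ A Y, (T.outN v (T.dominators Y S)).card ≤ (T.emb p (k + 2) S).card := by
  classical
  set q : Fin (k + 1) := ⟨p (k + 1), hp⟩ with hq
  set F : Finset (Fin k → Fin n) := Fintype.piFinset fun _ => U with hF
  set A : (Fin k → Fin n) → Finset (Fin n) := fun Y =>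
    U.filter fun v => q.insertNth (α := fun _ => Fin n) v Y ∈ T.emb p (k + 1) U with hA
  have hins : ∀ g : Fin (k + 1) → Fin n,
      q.insertNth (α := fun _ => Fin n) (g q) (q.removeNth g) = g := fun g =>
    Fin.insertNth_self_removeNth q g
  refine ⟨F, A, by simp [hF], fun Y hY =>
    ⟨Finset.filter_subset _ _, Fintype.mem_piFinset.1 hY⟩, ?_, ?_⟩
  · rw [← Finset.card_sigma]
    refine Finset.card_le_card_of_injOn (fun g => ⟨q.removeNth g, g q⟩) ?_ ?_
    · intro g hg
      rw [Finset.mem_coe] at hg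
      have hg' := (mem_emb.1 hg).2
      simp only [Finset.coe_sigma, Set.mem_sigma_iff, Finset.mem_coe, hA, hF,
        Fintype.mem_piFinset, Finset.mem_filter]
      exact ⟨fun i => hg' _, hg' _, by rw [hins]; exact hg⟩
    · intro g _ g' _ hgg
      simp only [Sigma.mk.injEq, heq_eq_eq] at hgg
      rw [← hins g, ← hins g', hgg.1, hgg.2]
  · simp_rw [← Finset.card_sigma]
    refine Finset.card_le_card_of_injOn (fun e => (Fin.snoc (α := fun _ => Fin n)
      (q.insertNth (α := fun _ => Fin n) e.2.1 e.1) e.2.2 : Fin (k + 2) → Fin n)) ?_ ?_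
    · rintro ⟨Y, v, w⟩ he
      simp only [Finset.coe_sigma, Set.mem_sigma_iff, Finset.mem_coe, hA,
        Finset.mem_filter, mem_outN, mem_dominators] at he
      obtain ⟨hY, ⟨hv, hg⟩, ⟨hw, hd⟩, ha⟩ := he
      rw [mem_emb] at hg
      rw [Finset.mem_coe, mem_emb]
      refine ⟨hg.1.snoc fun i => ⟨fun hi => ?_, fun hi => ?_⟩, ?_⟩
      · have hi : i = q := Fin.ext hi
        rw [hi, Fin.insertNth_apply_same]
        exact ha
      · have hi : i ≠ q := fun h => hi (by rw [h])
        obtain ⟨i, rfl⟩ := Fin.exists_succAbove_eq hi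
        rw [Fin.insertNth_apply_succAbove]
        exact hd i
      · intro i
        induction i using Fin.lastCases with
        | last => simpa using hw
        | cast i => simpa using hU (hg.2 i)
    · rintro ⟨Y, v, w⟩ _ ⟨Y', v', w'⟩ _ he
      simp only at he
      obtain ⟨he1, he2⟩ := Fin.snoc_injective2 he
      obtain ⟨rfl, rfl⟩ := Fin.insertNth_injective2 (p := q) he1
      subst he2
      rfl

/-- If `U` has many copies of the first `k + 1` vertices and `S` has few copies of the first
`k + 2` vertices, then fixing all vertices but one suitably gives a large set of vertices
with few out-neighbours among the candidates for the last vertex. -/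
lemma exists_fiber {k : ℕ} (hp : p (k + 1) < k + 1) {β E C : ℝ} (hU : U ⊆ S)
    (hne : U.Nonempty) (hE : 0 < E)
    (hden : β * (U.card : ℝ) ^ (k + 1) ≤ (T.emb p (k + 1) U).card)
    (hfew : ((T.emb p (k + 2) S).card : ℝ) < C) (hC : C ≤ β / 2 * (U.card : ℝ) ^ k * E) :
    ∃ (Y : Fin k → Fin n) (A : Finset (Fin n)), A ⊆ U ∧ (∀ i, Y i ∈ U) ∧
      β * U.card / 2 ≤ (A.card : ℝ) ∧
      ∑ v ∈ A, ((T.outN v (T.dominators Y S)).card : ℝ) ≤ E := by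
  obtain ⟨F, A, hF, hA, h1, h2⟩ := exists_fibers (T := T) hp hU
  have hFc : (F.card : ℝ) = (U.card : ℝ) ^ k := by exact_mod_cast hF
  by_contra! hcon
  have hUpos : (0 : ℝ) < U.card := by exact_mod_cast hne.card_pos
  have h3 : ∀ Y ∈ F, ((A Y).card : ℝ) ≤ β * U.card / 2 +
      U.card / E * ∑ v ∈ A Y, ((T.outN v (T.dominators Y S)).card : ℝ) := by
    intro Y hY
    have h0 : 0 ≤ ∑ v ∈ A Y, ((T.outN v (T.dominators Y S)).card : ℝ) :=
      Finset.sum_nonneg fun _ _ => Nat.cast_nonneg _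
    by_cases hb : β * U.card / 2 ≤ ((A Y).card : ℝ)
    · have h4 := hcon Y (A Y) (hA Y hY).1 (hA Y hY).2 hb
      have h5 : ((A Y).card : ℝ) ≤ U.card := by
        exact_mod_cast Finset.card_le_card (hA Y hY).1
      by_cases hβ : 0 ≤ β
      · have : (U.card : ℝ) / E * E ≤
            U.card / E * ∑ v ∈ A Y, ((T.outN v (T.dominators Y S)).card : ℝ) :=
          mul_le_mul_of_nonneg_left h4.le (div_nonneg hUpos.le hE.le)
        rw [div_mul_cancel₀ _ hE.ne'] at this
        nlinarith [mul_nonneg hβ hUpos.le]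
      · exfalso
        have : C < 0 := hC.trans_lt (by
          have : 0 < (U.card : ℝ) ^ k := by positivity
          nlinarith [mul_pos this hE])
        have : (0 : ℝ) ≤ (T.emb p (k + 2) S).card := Nat.cast_nonneg _
        linarith
    · have : 0 ≤ U.card / E * ∑ v ∈ A Y, ((T.outN v (T.dominators Y S)).card : ℝ) :=
        mul_nonneg (div_nonneg hUpos.le hE.le) h0
      linarith
  have h4 := Finset.sum_le_sum h3
  rw [Finset.sum_add_distrib, Finset.sum_const, nsmul_eq_mul, hFc, ← Finset.mul_sum] at h4
  have h1' : ((T.emb p (k + 1) U).card : ℝ) ≤ ∑ Y ∈ F, ((A Y).card : ℝ) := by exact_mod_cast h1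
  have h2' : ∑ Y ∈ F, ∑ v ∈ A Y, ((T.outN v (T.dominators Y S)).card : ℝ) <
      β / 2 * (U.card : ℝ) ^ k * E :=
    (lt_of_le_of_lt (by exact_mod_cast h2) hfew).trans_le hC
  have h5 : U.card / E * (∑ Y ∈ F, ∑ v ∈ A Y, ((T.outN v (T.dominators Y S)).card : ℝ)) <
      U.card / E * (β / 2 * (U.card : ℝ) ^ k * E) :=
    mul_lt_mul_of_pos_left h2' (div_pos hUpos hE)
  have h6 : U.card / E * (β / 2 * (U.card : ℝ) ^ k * E) = β / 2 * (U.card : ℝ) ^ (k + 1) := by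
    rw [div_mul_eq_mul_div, div_eq_iff hE.ne']
    ring
  have h7 : (U.card : ℝ) ^ k * (β * U.card / 2) = β / 2 * (U.card : ℝ) ^ (k + 1) := by ring
  rw [h6] at h5
  rw [h7] at h4
  linarith

/-- Sets smaller than `S` with few copies of the first `h` vertices contain large sparse
subsets. -/
def SparseBelow (T : Tournament n) (p : ℕ → ℕ) (h D : ℕ) (S : Finset (Fin n)) : Prop :=
  ∀ U : Finset (Fin n), U.card < S.card → ∀ z : ℝ, 0 < z → z ≤ 1 →
    ((T.emb p h U).card : ℝ) < z ^ D * (U.card : ℝ) ^ h →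
    ∃ U' ⊆ U, z ^ D * U.card ≤ (U'.card : ℝ) ∧ T.Sparse z U'

/-- The vertices of `A` whose value of `f` is at most twice the average are at least half
of `A`. -/
lemma half_card_le {α : Type*} (A : Finset α) (f : α → ℝ) (hf : ∀ v ∈ A, 0 ≤ f v) {E : ℝ}
    (hE : 0 < E) (hs : ∑ v ∈ A, f v ≤ E) :
    (A.card : ℝ) / 2 ≤ (A.filter fun v => A.card * f v ≤ 2 * E).card := by
  classical
  rcases A.eq_empty_or_nonempty with rfl | hA
  · simp
  have hc : (0 : ℝ) < A.card := by exact_mod_cast hA.card_pos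
  have h1 := Finset.card_filter_add_card_filter_not (s := A) (fun v => A.card * f v ≤ 2 * E)
  have h2 : ((A.filter fun v => ¬ (A.card * f v ≤ 2 * E)).card : ℝ) * (2 * E) ≤ A.card * E := by
    calc _ = ∑ v ∈ A.filter (fun v => ¬ (A.card * f v ≤ 2 * E)), 2 * E := by
          rw [Finset.sum_const, nsmul_eq_mul]
      _ ≤ ∑ v ∈ A.filter (fun v => ¬ (A.card * f v ≤ 2 * E)), A.card * f v :=
          Finset.sum_le_sum fun v hv => (not_le.1 (Finset.mem_filter.1 hv).2).le
      _ ≤ ∑ v ∈ A, A.card * f v :=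
          Finset.sum_le_sum_of_subset_of_nonneg (Finset.filter_subset _ _)
            fun v hv _ => mul_nonneg hc.le (hf v hv)
      _ ≤ A.card * E := by
          rw [← Finset.mul_sum]
          exact mul_le_mul_of_nonneg_left hs hc.le
  have h3 : ((A.filter fun v => ¬ (A.card * f v ≤ 2 * E)).card : ℝ) ≤ A.card / 2 := by
    refine le_of_mul_le_mul_right (h2.trans (le_of_eq ?_)) (mul_pos two_pos hE)
    ring
  have h4 : ((A.filter fun v => A.card * f v ≤ 2 * E).card : ℝ) +
      (A.filter fun v => ¬ (A.card * f v ≤ 2 * E)).card = A.card := by exact_mod_cast h1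
  linarith

/-- Few vertices of `W` have many in-neighbours in `A`. -/
lemma card_mul_le_of_inN {W R : Finset (Fin n)} {c d : ℝ} (hR : R ⊆ W)
    (hd : ∀ v ∈ A, ((T.outN v W).card : ℝ) ≤ d)
    (hc : ∀ w ∈ R, c ≤ ((T.inN A w).card : ℝ)) : R.card * c ≤ A.card * d := by
  have h1 : T.arcs A R ⊆ T.arcs A W := fun e he => by
    rw [mem_arcs] at he ⊢
    exact ⟨⟨he.1.1, hR he.1.2⟩, he.2⟩
  calc R.card * c = ∑ w ∈ R, c := by rw [Finset.sum_const, nsmul_eq_mul]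
    _ ≤ ∑ w ∈ R, ((T.inN A w).card : ℝ) := Finset.sum_le_sum hc
    _ = (T.arcs A R).card := by rw [card_arcs_eq_sum_inN]; push_cast; rfl
    _ ≤ (T.arcs A W).card := by exact_mod_cast Finset.card_le_card h1
    _ = ∑ v ∈ A, ((T.outN v W).card : ℝ) := by rw [card_arcs_eq_sum_outN]; push_cast; rfl
    _ ≤ ∑ v ∈ A, d := Finset.sum_le_sum hd
    _ = A.card * d := by rw [Finset.sum_const, nsmul_eq_mul]

/-- Selecting a sparse subset of `U` that is beaten by few vertices among those that could
extend its copies. -/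
lemma exists_selection {k D : ℕ} (hp : p (k + 1) < k + 1) {β z z₁ : ℝ} (hβ : 0 < β)
    (hU : U ⊆ S) (hUS : U.card < S.card) (hz : 0 < z) (hz₁ : 0 < z₁) (hz₁' : z₁ ≤ 1)
    (hlarge : β * S.card ≤ (U.card : ℝ))
    (hden : β * (U.card : ℝ) ^ (k + 1) ≤ (T.emb p (k + 1) U).card)
    (hfew : ((T.emb p (k + 2) S).card : ℝ) < z ^ D * (S.card : ℝ) ^ (k + 2))
    (ih : T.SparseBelow p (k + 2) D S)
    (hnum : z ^ D ≤ z₁ ^ D * (β ^ 2 / 4) ^ (k + 2)) {s : ℕ}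
    (hs : s = ⌈z₁ ^ D * (β ^ 2 / 4 * S.card)⌉₊) :
    ∃ (Y : Fin k → Fin n) (S' : Finset (Fin n)), S' ⊆ U ∧ (∀ i, Y i ∈ U) ∧ S'.card = s ∧
      T.Sparse z₁ S' ∧
      ∀ v ∈ S', ((T.outN v (T.dominators Y S)).card : ℝ) ≤
        8 * z ^ D / β ^ (k + 3) * S.card := by
  classical
  have hN : (0 : ℝ) < S.card := by exact_mod_cast (Nat.zero_le _).trans_lt hUS
  have hUpos : (0 : ℝ) < U.card := (mul_pos hβ hN).trans_le hlarge
  have hne : U.Nonempty := Finset.card_pos.1 (by exact_mod_cast hUpos)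
  have hzD : 0 < z ^ D := pow_pos hz D
  set E : ℝ := 2 * z ^ D * S.card ^ 2 / β ^ (k + 1) with hEdef
  have hE : 0 < E := div_pos (mul_pos (mul_pos two_pos hzD) (pow_pos hN 2)) (pow_pos hβ _)
  have hC : z ^ D * (S.card : ℝ) ^ (k + 2) ≤ β / 2 * (U.card : ℝ) ^ k * E := by
    have h1 : (β * S.card) ^ k ≤ (U.card : ℝ) ^ k :=
      pow_le_pow_left₀ (mul_pos hβ hN).le hlarge k
    calc z ^ D * (S.card : ℝ) ^ (k + 2) = β / 2 * (β * S.card) ^ k * E := by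
          rw [hEdef, mul_pow, pow_succ β k]
          field_simp
          ring
      _ ≤ _ := mul_le_mul_of_nonneg_right
        (mul_le_mul_of_nonneg_left h1 (by linarith)) hE.le
  obtain ⟨Y, A, hAU, hY, hAc, hAs⟩ := exists_fiber hp hU hne hE hden hfew hC
  have hhalf := half_card_le A (fun v => ((T.outN v (T.dominators Y S)).card : ℝ))
    (fun _ _ => Nat.cast_nonneg _) hE hAs
  set A' := A.filter fun v => A.card * ((T.outN v (T.dominators Y S)).card : ℝ) ≤ 2 * E
    with hA'
  have hA'A : A' ⊆ A := Finset.filter_subset _ _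
  have hAβ : β ^ 2 / 2 * S.card ≤ (A.card : ℝ) := by nlinarith
  have hA'c : β ^ 2 / 4 * S.card ≤ (A'.card : ℝ) := by linarith
  have hα : 0 < β ^ 2 / 4 := by positivity
  obtain ⟨S', hS'A, hS'c, hS's⟩ := ih A'
    ((Finset.card_le_card (hA'A.trans hAU)).trans_lt hUS) z₁ hz₁ hz₁' (by
      have h1 : ((T.emb p (k + 2) A').card : ℝ) ≤ (T.emb p (k + 2) S).card := by
        exact_mod_cast Finset.card_le_card (emb_mono ((hA'A.trans hAU).trans hU))
      refine (h1.trans_lt hfew).trans_le ?_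
      calc z ^ D * (S.card : ℝ) ^ (k + 2)
          ≤ z₁ ^ D * (β ^ 2 / 4) ^ (k + 2) * (S.card : ℝ) ^ (k + 2) :=
            mul_le_mul_of_nonneg_right hnum (pow_pos hN _).le
        _ = z₁ ^ D * (β ^ 2 / 4 * S.card) ^ (k + 2) := by rw [mul_pow]; ring
        _ ≤ z₁ ^ D * (A'.card : ℝ) ^ (k + 2) := mul_le_mul_of_nonneg_left
            (pow_le_pow_left₀ (mul_pos hα hN).le hA'c _) (pow_pos hz₁ D).le)
  obtain ⟨S'', hS'', hc, hsp⟩ := hS's.exists_subset hz₁.le (k := s) (by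
    rw [hs, Nat.ceil_le]
    exact (mul_le_mul_of_nonneg_left hA'c (pow_pos hz₁ D).le).trans hS'c)
  refine ⟨Y, S'', hS''.trans (hS'A.trans (hA'A.trans hAU)), hY, hc, hsp, fun v hv => ?_⟩
  have h1 := (Finset.mem_filter.1 (hS'A (hS'' hv))).2
  have h2 : β ^ 2 / 2 * S.card * ((T.outN v (T.dominators Y S)).card : ℝ) ≤ 2 * E :=
    (mul_le_mul_of_nonneg_right hAβ (Nat.cast_nonneg _)).trans h1
  have h3 : 2 * E = β ^ 2 / 2 * S.card * (8 * z ^ D / β ^ (k + 3) * S.card) := by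
    rw [hEdef, pow_add β k 3, pow_succ β k]
    field_simp
    ring
  rw [h3] at h2
  exact le_of_mul_le_mul_left h2 (by positivity)

/-- If disjoint blocks of `S` are pairwise nearly complete in the forward direction and have
many copies of the first `k + 1` vertices, while `S` has few copies of the first `k + 2`
vertices, then `S` has a large sparse subset meeting all blocks. -/
lemma exists_sparse_of_blocks {k D K : ℕ} (hp : p (k + 1) < k + 1) {β z m r : ℝ}
    (hβ : 0 < β) (hβ1 : β ≤ 1) (hz : 0 < z) (hK : 1 ≤ K) (hKz : 3 / 4 * K * z ≤ 1)
    (B : ℕ → Finset (Fin n)) (hBS : ∀ j < K, B j ⊆ S) (hBlt : ∀ j < K, (B j).card < S.card)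
    (hd : ∀ l < K, ∀ j < l, Disjoint (B j) (B l))
    (hB : ∀ j < K, m + K * r ≤ (B j).card) (hm : β * S.card ≤ m) (hr : β * S.card ≤ r)
    (hdeg : ∀ l < K, ∀ j < l, ∀ v ∈ B l, (k + 1) * ((T.outN v (B j)).card : ℝ) ≤ r / 2)
    (hden : ∀ l < K, ∀ U ⊆ B l, m ≤ (U.card : ℝ) →
      β * (U.card : ℝ) ^ (k + 1) ≤ (T.emb p (k + 1) U).card)
    (hfew : ((T.emb p (k + 2) S).card : ℝ) < z ^ D * (S.card : ℝ) ^ (k + 2))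
    (ih : T.SparseBelow p (k + 2) D S)
    (hnum₁ : 1 ≤ (3 / 4 * K : ℝ) ^ D * (β ^ 2 / 4) ^ (k + 2))
    (hnum₂ : 64 * z ^ D ≤ z * β ^ (k + 4)) :
    ∃ S' ⊆ S, z ^ D * S.card ≤ (S'.card : ℝ) ∧ T.Sparse z S' := by
  classical
  have hN : (0 : ℝ) < S.card := by exact_mod_cast (Nat.zero_le _).trans_lt (hBlt 0 hK)
  have hK' : (1 : ℝ) ≤ K := by exact_mod_cast hK
  set z₁ : ℝ := 3 / 4 * K * z with hz₁
  have hz₁pos : 0 < z₁ := by positivity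
  have hz₁D : z₁ ^ D = z ^ D * (3 / 4 * K : ℝ) ^ D := by rw [hz₁, mul_pow]; ring
  have hnum : z ^ D ≤ z₁ ^ D * (β ^ 2 / 4) ^ (k + 2) := by
    rw [hz₁D, mul_assoc]
    exact le_mul_of_one_le_right (pow_pos hz D).le hnum₁
  obtain ⟨s, hs⟩ : ∃ s, s = ⌈z₁ ^ D * (β ^ 2 / 4 * S.card)⌉₊ := ⟨_, rfl⟩
  have hs' : z₁ ^ D * (β ^ 2 / 4 * S.card) ≤ s := hs ▸ Nat.le_ceil _
  have hspos : (0 : ℝ) < s := lt_of_lt_of_le (by positivity) hs'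
  have hrpos : 0 < r := (mul_pos hβ hN).trans_le hr
  obtain ⟨A, hA, hQ⟩ := exists_peel (P := fun A => A.card = s ∧ T.Sparse z₁ A)
    (Q := fun A w => ((T.inN A w).card : ℝ) ≤ z / 4 * s) (m := m) hrpos.le K B hB (by
    intro l hl U hUB hUm
    obtain ⟨Y, S', hS'U, hY, hc, hsp, hout⟩ := exists_selection hp hβ (hUB.trans (hBS l hl))
      ((Finset.card_le_card hUB).trans_lt (hBlt l hl)) hz hz₁pos hKz (hm.trans hUm)
      (hden l hl U hUB hUm) hfew ih hnum hs
    refine ⟨S', hS'U, ⟨hc, hsp⟩, Finset.univ.filter (fun w => (∃ i, ¬ T.adj w (Y i)) ∨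
      ¬ ((T.inN S' w).card : ℝ) ≤ z / 4 * s), ?_, ?_⟩
    · intro j hj R' hR' hR'B
      have hne : ∀ i, ∀ w ∈ B j, w ≠ Y i := fun i w hw h =>
        Finset.disjoint_left.1 (hd l hl j hj) hw (h ▸ hUB (hY i))
      set R₁ := Finset.univ.biUnion fun i => T.outN (Y i) (B j)
      set R₂ := (T.dominators Y S).filter fun w => ¬ ((T.inN S' w).card : ℝ) ≤ z / 4 * s
      have hsub : R' ⊆ R₁ ∪ R₂ := by
        intro w hw
        have hwB := hR'B hw
        rw [Finset.mem_union]
        by_cases hex : ∃ i, ¬ T.adj w (Y i)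
        · obtain ⟨i, hi⟩ := hex
          refine Or.inl (Finset.mem_biUnion.2 ⟨i, Finset.mem_univ i, mem_outN.2 ⟨hwB, ?_⟩⟩)
          exact (T.total w (Y i) (hne i w hwB)).resolve_left hi
        · refine Or.inr (Finset.mem_filter.2 ⟨mem_dominators.2 ⟨hBS j (hj.trans hl) hwB, ?_⟩, ?_⟩)
          · exact fun i => not_not.1 fun hi => hex ⟨i, hi⟩
          · exact ((Finset.mem_filter.1 (hR' hw)).2).resolve_left hex
      have h₁ : (R₁.card : ℝ) ≤ r / 2 := by
        have h0 : (R₁.card : ℝ) ≤ ∑ i : Fin k, ((T.outN (Y i) (B j)).card : ℝ) := by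
          exact_mod_cast Finset.card_biUnion_le
        have h1 : ∀ i ∈ Finset.univ, ((T.outN (Y i) (B j)).card : ℝ) ≤ r / 2 / (k + 1) :=
          fun i _ => by
            rw [le_div_iff₀ (by positivity), mul_comm]
            exact hdeg l hl j hj (Y i) (hUB (hY i))
        have h2 := Finset.sum_le_sum h1
        rw [Finset.sum_const, nsmul_eq_mul, Finset.card_univ, Fintype.card_fin] at h2
        refine (h0.trans h2).trans ?_
        rw [← mul_div_assoc, div_le_iff₀ (by positivity)]
        nlinarith
      have h₂ : (R₂.card : ℝ) ≤ r / 2 := by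
        have h1 := card_mul_le_of_inN (T := T) (R := R₂) (Finset.filter_subset _ _) hout
          (fun w hw => (not_le.1 (Finset.mem_filter.1 hw).2).le)
        rw [hc] at h1
        have h2 : R₂.card * (z / 4) ≤ 8 * z ^ D / β ^ (k + 3) * S.card := by
          refine le_of_mul_le_mul_right ?_ hspos
          linarith
        have h3 : 8 * z ^ D / β ^ (k + 3) * S.card ≤ z / 4 * (r / 2) := by
          rw [div_mul_eq_mul_div, div_le_iff₀ (by positivity)]
          calc 8 * z ^ D * S.card ≤ (z * β ^ (k + 4)) / 8 * S.card := by gcongr; linarith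
            _ = z / 8 * β ^ (k + 3) * (β * S.card) := by ring
            _ ≤ z / 8 * β ^ (k + 3) * r := by gcongr
            _ = _ := by ring
        refine le_of_mul_le_mul_left (a := z / 4) ?_ (by positivity)
        linarith
      have h3 : (R'.card : ℝ) ≤ R₁.card + R₂.card := by
        exact_mod_cast (Finset.card_le_card hsub).trans (Finset.card_union_le _ _)
      linarith
    · intro j hj w hw hwR
      by_contra hcon
      exact hwR (Finset.mem_filter.2 ⟨Finset.mem_univ w, Or.inr hcon⟩))
  obtain ⟨X, hX, hXc, hXs⟩ := sparse_biUnion (T := T) (z := z) (K := K) (s := s) (z₁ := z₁)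
    (τ := z / 4) (A := A)
    (fun l hl j hj => (hd l hl j hj).mono (hA j (hj.trans hl)).1 (hA l hl).1)
    (fun l hl => (hA l hl).2.1) (fun l hl => (hA l hl).2.2) (by positivity)
    hQ (by rw [hz₁]; apply le_of_eq; ring)
  refine ⟨X, fun v hv => ?_, ?_, hXs⟩
  · obtain ⟨l, hl, hv⟩ := hX v hv
    exact hBS l hl ((hA l hl).1 hv)
  · rw [hXc]
    push_cast
    have h0 : β ^ 2 / 4 ≤ 1 := by nlinarith
    have h1 : (β ^ 2 / 4) ^ (k + 2) ≤ β ^ 2 / 4 :=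
      pow_le_of_le_one (by positivity) h0 (by omega)
    have h2 : z ^ D ≤ z₁ ^ D * (β ^ 2 / 4) := hnum.trans (by gcongr)
    calc z ^ D * S.card ≤ z₁ ^ D * (β ^ 2 / 4) * S.card := by gcongr
      _ ≤ 1 * s := by rw [one_mul, mul_assoc]; exact hs'
      _ ≤ K * s := by gcongr

/-- If there are few arcs from each block to the earlier blocks, then some large subset has few
copies of the first `k + 1` vertices, or `S` has a large sparse subset. -/
lemma exists_few_copies_or_sparse {k D K s : ℕ} (hp : p (k + 1) < k + 1) {β z : ℝ}
    (hβ : 0 < β) (hβ1 : β ≤ 1) (hz : 0 < z) (hK : 2 ≤ K) (hKz : 3 / 4 * K * z ≤ 1)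
    (B : ℕ → Finset (Fin n)) (hBS : ∀ j < K, B j ⊆ S) (hBs : ∀ j < K, (B j).card = s)
    (hs : 0 < s) (hd : ∀ l < K, ∀ j < l, Disjoint (B j) (B l))
    (harcs : ∀ l < K, 32 * (k + 1) * K *
      ((T.arcs (B l) ((Finset.range l).biUnion B)).card : ℝ) ≤ (s : ℝ) ^ 2)
    (hsβ : β * S.card ≤ s / (4 * K))
    (hfew : ((T.emb p (k + 2) S).card : ℝ) < z ^ D * (S.card : ℝ) ^ (k + 2))
    (ih : T.SparseBelow p (k + 2) D S)
    (hnum₁ : 1 ≤ (3 / 4 * K : ℝ) ^ D * (β ^ 2 / 4) ^ (k + 2))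
    (hnum₂ : 64 * z ^ D ≤ z * β ^ (k + 4)) :
    (∃ U ⊆ S, (s : ℝ) / 2 ≤ U.card ∧
      ((T.emb p (k + 1) U).card : ℝ) < β * (U.card : ℝ) ^ (k + 1)) ∨
    ∃ S' ⊆ S, z ^ D * S.card ≤ (S'.card : ℝ) ∧ T.Sparse z S' := by
  classical
  rw [or_iff_not_imp_left]
  intro hU
  push Not at hU
  have hs' : (0 : ℝ) < s := by exact_mod_cast hs
  have hK' : (2 : ℝ) ≤ K := by exact_mod_cast hK
  have hKpos : (0 : ℝ) < K := by linarith
  set t : ℝ := s / (8 * (k + 1) * K) with ht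
  have htpos : 0 < t := by positivity
  have h2s : s + s ≤ S.card := by
    have := Finset.card_le_card (Finset.union_subset (hBS 0 (by omega)) (hBS 1 (by omega)))
    rwa [Finset.card_union_of_disjoint (hd 1 (by omega) 0 (by omega)), hBs 0 (by omega),
      hBs 1 (by omega)] at this
  set W : ℕ → Finset (Fin n) := fun l => (Finset.range l).biUnion B with hW
  set B' : ℕ → Finset (Fin n) := fun l =>
    (B l).filter fun v => ((T.outN v (W l)).card : ℝ) ≤ t with hB'
  have hB'B : ∀ l, B' l ⊆ B l := fun l => Finset.filter_subset _ _
  have hcard : ∀ l < K, 3 / 4 * (s : ℝ) ≤ (B' l).card := by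
    intro l hl
    have h1 : ((B' l).card : ℝ) +
        ((B l).filter fun v => ¬ ((T.outN v (W l)).card : ℝ) ≤ t).card = s := by
      rw [← hBs l hl]
      exact_mod_cast Finset.card_filter_add_card_filter_not (s := B l)
        (fun v => ((T.outN v (W l)).card : ℝ) ≤ t)
    have h2 : (((B l).filter fun v => ¬ ((T.outN v (W l)).card : ℝ) ≤ t).card : ℝ) * t ≤
        (T.arcs (B l) (W l)).card := by
      rw [card_arcs_eq_sum_outN, ← nsmul_eq_mul, ← Finset.sum_const]
      push_cast
      exact (Finset.sum_le_sum fun v hv => (not_le.1 (Finset.mem_filter.1 hv).2).le).trans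
        (Finset.sum_le_sum_of_subset_of_nonneg (Finset.filter_subset _ _)
          fun v hv _ => Nat.cast_nonneg _)
    have h3 : (((B l).filter fun v => ¬ ((T.outN v (W l)).card : ℝ) ≤ t).card : ℝ) ≤ s / 4 := by
      refine le_of_mul_le_mul_right (h2.trans ?_) htpos
      have h4 := harcs l hl
      have h5 : (s : ℝ) / 4 * t = (s : ℝ) ^ 2 / (32 * (k + 1) * K) := by
        rw [ht]
        field_simp
        ring
      rw [h5, le_div_iff₀ (by positivity)]
      linarith
    linarith
  have hr : (K : ℝ) * (s / (4 * K)) = s / 4 := by field_simp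
  refine exists_sparse_of_blocks hp hβ hβ1 hz (by omega) hKz B'
    (m := s / 2) (r := s / (4 * K))
    (fun j hj => (hB'B j).trans (hBS j hj)) (fun j hj => ?_)
    (fun l hl j hj => (hd l hl j hj).mono (hB'B j) (hB'B l)) (fun j hj => ?_) ?_ hsβ
    (fun l hl j hj v hv => ?_) (fun l hl U hUB hUm => ?_) hfew ih hnum₁ hnum₂
  · have := Finset.card_le_card (hB'B j)
    rw [hBs j hj] at this
    omega
  · rw [hr]
    linarith [hcard j hj]
  · refine hsβ.trans (div_le_div_of_nonneg_left hs'.le two_pos (by linarith))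
  · have h1 : ((T.outN v (B' j)).card : ℝ) ≤ t := by
      refine le_trans ?_ (Finset.mem_filter.1 hv).2
      exact_mod_cast Finset.card_le_card (outN_mono ((hB'B j).trans
        (Finset.subset_biUnion_of_mem B (Finset.mem_range.2 hj))))
    have h2 : ((k : ℝ) + 1) * t = s / (4 * K) / 2 := by
      rw [ht]
      field_simp
      ring
    rw [← h2]
    gcongr
  · exact hU U (hUB.trans ((hB'B l).trans (hBS l hl))) hUm

open Classical in
/-- The copies of the first `h` vertices of the pattern whose `i`-th vertex lies in `V i`. -/
noncomputable def embIn (T : Tournament n) (p : ℕ → ℕ) (h : ℕ) (V : ℕ → Finset (Fin n)) :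
    Finset (Fin h → Fin n) :=
  Finset.univ.filter fun f => T.IsEmb p f ∧ ∀ i : Fin h, f i ∈ V i

lemma mem_embIn {V : ℕ → Finset (Fin n)} {f : Fin h → Fin n} :
    f ∈ T.embIn p h V ↔ T.IsEmb p f ∧ ∀ i : Fin h, f i ∈ V i := by
  simp [embIn]

lemma inN_subset {w : Fin n} : T.inN A w ⊆ A := fun _ hv => (mem_inN.1 hv).1

lemma outN_subset {v : Fin n} : T.outN v B ⊆ B := fun _ hw => (mem_outN.1 hw).1

/-- If all pairs of large disjoint sets have positive density in both directions, then there are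
many copies of any pattern. -/
lemma exists_many_copies (p : ℕ → ℕ) {lam : ℝ} (hlam : 0 < lam) (g : ℕ) (x : ℝ) (hx : 0 < x) :
    ∃ c > (0 : ℝ), ∃ φ > (0 : ℝ), ∀ (n : ℕ) (T : Tournament n) (S : Finset (Fin n)) (M : ℝ)
      (V : ℕ → Finset (Fin n)), 0 < M → (∀ i < g, V i ⊆ S) → (∀ i < g, x * M ≤ (V i).card) →
      (∀ l < g, ∀ j < l, Disjoint (V j) (V l)) →
      (∀ A ⊆ S, ∀ B ⊆ S, Disjoint A B → c * M ≤ A.card → c * M ≤ B.card →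
        lam * A.card * B.card < (T.arcs A B).card) →
      φ * M ^ g ≤ (T.embIn p g V).card := by
  classical
  induction g generalizing x with
  | zero =>
    refine ⟨1, one_pos, 1, one_pos, fun n T S M V hM _ _ _ _ => ?_⟩
    have : (T.embIn p 0 V).Nonempty := ⟨Fin.elim0, mem_embIn.2 ⟨fun i => i.elim0,
      fun i => i.elim0⟩⟩
    rw [pow_zero, mul_one]
    exact_mod_cast this.card_pos
  | succ g ih =>
    obtain ⟨c₁, hc₁, φ₁, hφ₁, ih⟩ := ih (lam * x) (mul_pos hlam hx)
    set c := min c₁ (x / (2 * (g + 1))) with hc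
    have hcx : (g + 1) * c ≤ x / 2 := by
      have h1 : c ≤ x / (2 * (g + 1)) := min_le_right _ _
      rw [le_div_iff₀ (by positivity)] at h1
      linarith
    have hcpos : 0 < c := lt_min hc₁ (by positivity)
    have hcx' : c ≤ x := by
      nlinarith [mul_nonneg (Nat.cast_nonneg (α := ℝ) g) hcpos.le]
    refine ⟨c, hcpos, x / 2 * φ₁, by positivity, fun n T S M V hM hVS hVc hVd hcoh => ?_⟩
    set W : Fin n → ℕ → Finset (Fin n) := fun v i =>
      if i = p g then T.inN (V i) v else T.outN v (V i) with hW
    have hWV : ∀ v i, W v i ⊆ V i := by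
      intro v i
      simp only [hW]
      split_ifs
      · exact inN_subset
      · exact outN_subset
    set bad : ℕ → Finset (Fin n) := fun i =>
      (V g).filter fun v => ((W v i).card : ℝ) < lam * (V i).card with hbad
    have hbad_lt : ∀ i < g, ((bad i).card : ℝ) ≤ c * M := by
      intro i hi
      by_contra! hcon
      have hdisj : Disjoint (V i) (bad i) :=
        (hVd g (by omega) i hi).mono_right (Finset.filter_subset _ _)
      have hbS : bad i ⊆ S := (Finset.filter_subset _ _).trans (hVS g (by omega))
      have hVi : c * M ≤ (V i).card :=
        (mul_le_mul_of_nonneg_right hcx' hM.le).trans (hVc i (by omega))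
      have hsum : ∑ v ∈ bad i, ((W v i).card : ℝ) ≤ (bad i).card * (lam * (V i).card) := by
        rw [← nsmul_eq_mul, ← Finset.sum_const]
        exact Finset.sum_le_sum fun v hv => (Finset.mem_filter.1 hv).2.le
      by_cases hip : i = p g
      · have h1 := hcoh (V i) (hVS i (by omega)) (bad i) hbS hdisj hVi hcon.le
        rw [card_arcs_eq_sum_inN] at h1
        simp only [hW, hip, if_true] at hsum
        rw [hip] at h1
        push_cast at h1
        linarith
      · have h1 := hcoh (bad i) hbS (V i) (hVS i (by omega)) hdisj.symm hcon.le hVi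
        rw [card_arcs_eq_sum_outN] at h1
        simp only [hW, hip, if_false] at hsum
        push_cast at h1
        linarith
    set good := V g \ (Finset.range g).biUnion bad with hgood
    have hgood_card : x / 2 * M ≤ good.card := by
      have h1 : (((Finset.range g).biUnion bad).card : ℝ) ≤ g * (c * M) := by
        have h2 : (((Finset.range g).biUnion bad).card : ℝ) ≤
            ∑ i ∈ Finset.range g, ((bad i).card : ℝ) := by
          exact_mod_cast Finset.card_biUnion_le
        refine h2.trans ((Finset.sum_le_sum fun i hi =>
          hbad_lt i (Finset.mem_range.1 hi)).trans ?_)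
        rw [Finset.sum_const, Finset.card_range, nsmul_eq_mul]
      have h2 : ((V g).card : ℝ) ≤ good.card + ((Finset.range g).biUnion bad).card := by
        exact_mod_cast Finset.card_le_card_sdiff_add_card
      have h3 := hVc g (by omega)
      nlinarith [mul_le_mul_of_nonneg_right hcx hM.le, mul_pos hcpos hM]
    have hfib : ∀ v ∈ good, φ₁ * M ^ g ≤ (T.embIn p g (W v)).card := by
      intro v hv
      obtain ⟨hvg, hvb⟩ := Finset.mem_sdiff.1 hv
      refine ih n T S M (W v) hM (fun i hi => (hWV v i).trans (hVS i (by omega))) ?_ ?_ ?_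
      · intro i hi
        have h1 : lam * (V i).card ≤ (W v i).card := by
          by_contra! hcon
          exact hvb (Finset.mem_biUnion.2
            ⟨i, Finset.mem_range.2 hi, Finset.mem_filter.2 ⟨hvg, hcon⟩⟩)
        refine le_trans ?_ h1
        rw [mul_assoc]
        exact mul_le_mul_of_nonneg_left (hVc i (by omega)) hlam.le
      · exact fun l hl j hj => (hVd l (by omega) j hj).mono (hWV v j) (hWV v l)
      · intro A hA B hB hAB hAc hBc
        have hcc : c * M ≤ c₁ * M := mul_le_mul_of_nonneg_right (min_le_left _ _) hM.le
        exact hcoh A hA B hB hAB (hcc.trans hAc) (hcc.trans hBc)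
    have hinj : ∑ v ∈ good, (T.embIn p g (W v)).card ≤ (T.embIn p (g + 1) V).card := by
      rw [← Finset.card_sigma]
      refine Finset.card_le_card_of_injOn
        (fun e => (Fin.snoc (α := fun _ => Fin n) e.2 e.1 : Fin (g + 1) → Fin n)) ?_ ?_
      · rintro ⟨v, f⟩ he
        simp only [Finset.coe_sigma, Set.mem_sigma_iff, Finset.mem_coe, mem_embIn] at he
        obtain ⟨hv, hf, hfW⟩ := he
        rw [Finset.mem_coe, mem_embIn]
        refine ⟨hf.snoc fun i => ⟨fun hi => ?_, fun hi => ?_⟩, fun i => ?_⟩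
        · have := hfW i
          simp only [hW, hi, if_true] at this
          exact (mem_inN.1 this).2
        · have := hfW i
          simp only [hW, hi, if_false] at this
          exact (mem_outN.1 this).2
        · induction i using Fin.lastCases with
          | last => simpa using (Finset.mem_sdiff.1 hv).1
          | cast i => simpa using hWV v i (hfW i)
      · rintro ⟨v, f⟩ _ ⟨v', f'⟩ _ he
        obtain ⟨rfl, rfl⟩ := Fin.snoc_injective2 he
        rfl
    calc x / 2 * φ₁ * M ^ (g + 1) = x / 2 * M * (φ₁ * M ^ g) := by ring
      _ ≤ good.card * (φ₁ * M ^ g) := by gcongr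
      _ ≤ ∑ v ∈ good, ((T.embIn p g (W v)).card : ℝ) := by
        rw [← nsmul_eq_mul, ← Finset.sum_const]
        exact Finset.sum_le_sum hfib
      _ ≤ _ := by exact_mod_cast hinj

/-- Some subset of prescribed size has at most average sum. -/
lemma exists_subset_sum_le {α : Type*} [DecidableEq α] {A : Finset α} {f : α → ℝ} {s : ℕ}
    (hs : s ≤ A.card) : ∃ A' ⊆ A, A'.card = s ∧
      A.card * ∑ v ∈ A', f v ≤ s * ∑ v ∈ A, f v := by
  induction hm : A.card - s generalizing A with
  | zero =>
    have : A.card = s := by omega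
    exact ⟨A, subset_rfl, this, by rw [this]⟩
  | succ d ih =>
    rcases Nat.eq_zero_or_pos s with rfl | hs0
    · exact ⟨∅, by simp⟩
    obtain ⟨v, hv, hmax⟩ := Finset.exists_max_image A f (Finset.card_pos.1 (by omega))
    have hc := Finset.card_erase_of_mem hv
    obtain ⟨A', h1, h2, h3⟩ := ih (A := A.erase v) (by omega) (by omega)
    refine ⟨A', h1.trans (Finset.erase_subset _ _), h2, ?_⟩
    have h4 := Finset.add_sum_erase A f hv
    have h5 : ∑ w ∈ A, f w ≤ A.card * f v := by
      rw [← nsmul_eq_mul]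
      exact Finset.sum_le_card_nsmul A f _ hmax
    have h6 : ((A.erase v).card : ℝ) = A.card - 1 := by
      rw [hc, Nat.cast_sub (by omega), Nat.cast_one]
    have h7 : (0 : ℝ) < A.card - 1 := by
      rw [← h6]
      exact_mod_cast (by omega : 0 < (A.erase v).card)
    rw [h6] at h3
    have h8 : (A.card : ℝ) * ∑ w ∈ A.erase v, f w ≤ (A.card - 1) * ∑ w ∈ A, f w := by
      rw [← h4] at h5 ⊢
      nlinarith
    refine le_of_mul_le_mul_left ?_ h7
    calc ((A.card : ℝ) - 1) * (A.card * ∑ v ∈ A', f v)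
        = A.card * ((A.card - 1) * ∑ v ∈ A', f v) := by ring
      _ ≤ A.card * (s * ∑ v ∈ A.erase v, f v) := by gcongr
      _ = s * (A.card * ∑ v ∈ A.erase v, f v) := by ring
      _ ≤ s * ((A.card - 1) * ∑ v ∈ A, f v) := by gcongr
      _ = _ := by ring

/-- Two sparse-to-each-other sets may be shrunk to a common size. -/
lemma exists_subsets_arcs_le {lam : ℝ} {s : ℕ} (hs : 0 < s) (hA : s ≤ A.card) (hB : s ≤ B.card)
    (h : ((T.arcs A B).card : ℝ) ≤ lam * A.card * B.card) :
    ∃ A' ⊆ A, ∃ B' ⊆ B, A'.card = s ∧ B'.card = s ∧ ((T.arcs A' B').card : ℝ) ≤ lam * s ^ 2 := by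
  classical
  have hA0 : (0 : ℝ) < A.card := by exact_mod_cast hs.trans_le hA
  have hB0 : (0 : ℝ) < B.card := by exact_mod_cast hs.trans_le hB
  obtain ⟨A', hA', hAs, h1⟩ := exists_subset_sum_le (f := fun v => ((T.outN v B).card : ℝ)) hA
  obtain ⟨B', hB', hBs, h2⟩ := exists_subset_sum_le (f := fun v => ((T.inN A' v).card : ℝ)) hB
  refine ⟨A', hA', B', hB', hAs, hBs, ?_⟩
  have e1 : ∑ v ∈ A', ((T.outN v B).card : ℝ) = (T.arcs A' B).card := by
    rw [card_arcs_eq_sum_outN]; push_cast; rfl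
  have e2 : ∑ v ∈ A, ((T.outN v B).card : ℝ) = (T.arcs A B).card := by
    rw [card_arcs_eq_sum_outN]; push_cast; rfl
  have e3 : ∑ v ∈ B', ((T.inN A' v).card : ℝ) = (T.arcs A' B').card := by
    rw [card_arcs_eq_sum_inN]; push_cast; rfl
  have e4 : ∑ v ∈ B, ((T.inN A' v).card : ℝ) = (T.arcs A' B).card := by
    rw [card_arcs_eq_sum_inN]; push_cast; rfl
  rw [e1, e2] at h1
  rw [e3, e4] at h2
  refine le_of_mul_le_mul_left ?_ (mul_pos hA0 hB0)
  calc (A.card : ℝ) * B.card * (T.arcs A' B').card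
      = A.card * (B.card * (T.arcs A' B').card) := by ring
    _ ≤ A.card * (s * (T.arcs A' B).card) := by gcongr
    _ = s * (A.card * (T.arcs A' B).card) := by ring
    _ ≤ s * (s * (T.arcs A B).card) := by gcongr
    _ ≤ s * (s * (lam * A.card * B.card)) := by gcongr
    _ = _ := by ring

/-- From a sparse set one obtains a much sparser one, unless `S` has a large `z`-sparse subset. -/
lemma exists_sparser {k D D' K : ℕ} (hp : p (k + 1) < k + 1) (hz : 0 < z)
    (hK : 32 * (k + 1) ≤ K) (hzK : z * K ^ 4 < 1)
    (hV : ∀ U : Finset (Fin n), ∀ z : ℝ, 0 < z → z ≤ 1 →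
      ((T.emb p (k + 1) U).card : ℝ) < z ^ D' * (U.card : ℝ) ^ (k + 1) →
      ∃ U' ⊆ U, z ^ D' * U.card ≤ (U'.card : ℝ) ∧ T.Sparse z U')
    (hD : (4 * (8 * D' + 7) + 2) * (k + 2) ≤ D) (hN : 1 < z ^ D * S.card)
    (hfew : ((T.emb p (k + 2) S).card : ℝ) < z ^ D * (S.card : ℝ) ^ (k + 2))
    (ih : T.SparseBelow p (k + 2) D S) (hA : A ⊆ S) (hAs : T.Sparse ((K : ℝ) ^ 4)⁻¹ A)
    (hAc : (S.card : ℝ) ≤ K ^ (8 * D' + 4) * A.card) :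
    (∃ A' ⊆ S, T.Sparse (((K ^ 2 : ℕ) : ℝ) ^ 4)⁻¹ A' ∧
      (S.card : ℝ) ≤ ((K ^ 2 : ℕ) : ℝ) ^ (8 * D' + 4) * A'.card) ∨
    ∃ S' ⊆ S, z ^ D * S.card ≤ (S'.card : ℝ) ∧ T.Sparse z S' := by
  classical
  have hK32 : 32 ≤ K := by omega
  have hKr : (32 : ℝ) ≤ K := by exact_mod_cast hK32
  have hK1 : (1 : ℝ) ≤ K := by linarith
  have hKpos : (0 : ℝ) < K := by linarith
  have hzK1 : z * K ≤ 1 := by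
    have : (K : ℝ) ≤ K ^ 4 := le_self_pow₀ hK1 (by norm_num)
    nlinarith
  have hz1 : z ≤ 1 := by nlinarith
  have hDl : 8 * D' + 7 ≤ D := by nlinarith
  have hMK : (K : ℝ) ≤ A.card := by
    have h1 : z ^ D * S.card ≤ z * A.card := by
      calc z ^ D * S.card ≤ z ^ D * (K ^ (8 * D' + 4) * A.card) := by gcongr
        _ ≤ z ^ (2 * D' + 1 + 1) * (K ^ (8 * D' + 4) * A.card) := by
          gcongr ?_ * _
          exact pow_le_pow_of_le_one hz.le hz1 (by omega)
        _ = (z * K ^ 4) ^ (2 * D' + 1) * (z * A.card) := by ring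
        _ ≤ 1 * (z * A.card) := by
          gcongr
          exact pow_le_one₀ (by positivity) hzK.le
        _ = _ := one_mul _
    have h2 : z * K < z * A.card := by linarith
    exact (lt_of_mul_lt_mul_left h2 hz.le).le
  obtain ⟨s, hs⟩ : ∃ s, s = A.card / K := ⟨_, rfl⟩
  have hs0 : 0 < s := hs ▸ Nat.div_pos (by exact_mod_cast hMK) (by omega)
  have hsr : (0 : ℝ) < s := by exact_mod_cast hs0
  have hKs : K * s ≤ A.card := hs ▸ Nat.mul_div_le _ _
  have hM2 : (A.card : ℝ) ≤ 2 * K * s := by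
    have h1 : A.card < K * (s + 1) := hs ▸ Nat.lt_mul_div_succ _ (by omega)
    have h2 : A.card ≤ 2 * K * s := by nlinarith
    exact_mod_cast h2
  have hNs : (S.card : ℝ) ≤ 2 * K ^ (8 * D' + 5) * s := by
    calc (S.card : ℝ) ≤ K ^ (8 * D' + 4) * A.card := hAc
      _ ≤ K ^ (8 * D' + 4) * (2 * K * s) := by gcongr
      _ = _ := by ring
  obtain ⟨A₁, hA₁, hA₁c, r, hr, hback⟩ := hAs.exists_subset (by positivity) hKs
  obtain ⟨B, hB, hBr⟩ := exists_intervals hr K s hA₁c.ge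
  have key := exists_few_copies_or_sparse (T := T) (S := S) (D := D) (s := s) (K := K) hp
    (β := ((K : ℝ) ^ (8 * D' + 7))⁻¹) (by positivity)
    (inv_le_one_of_one_le₀ (one_le_pow₀ hK1)) hz (by omega) (by nlinarith) B
    (fun j hj => (hB j hj).1.trans (hA₁.trans hA)) (fun j hj => (hB j hj).2) hs0
    (fun l hl j hj => Finset.disjoint_left.2 fun a ha hb =>
      lt_irrefl _ (hBr l hl j hj a ha a hb)) ?_ ?_ hfew ih ?_ ?_
  · refine key.imp_left ?_
    rintro ⟨U, hU, hUs, hUe⟩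
    obtain ⟨A', hA', hA'c, hA's⟩ := hV U (((K ^ 2 : ℕ) : ℝ) ^ 4)⁻¹ (by positivity)
      (inv_le_one_of_one_le₀ (one_le_pow₀ (by exact_mod_cast Nat.one_le_pow _ _ (by omega))))
      (hUe.trans_le (by
        gcongr
        rw [inv_pow]
        refine inv_anti₀ (by positivity) ?_
        push_cast
        rw [← pow_mul, ← pow_mul]
        exact pow_le_pow_right₀ hK1 (by omega)))
    refine ⟨A', hA'.trans hU, hA's, ?_⟩
    have h1 : (U.card : ℝ) ≤ K ^ (8 * D') * A'.card := by
      rw [inv_pow, inv_mul_le_iff₀ (by positivity)] at hA'c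
      refine hA'c.trans (le_of_eq ?_)
      push_cast
      ring
    calc (S.card : ℝ) ≤ 2 * K ^ (8 * D' + 5) * s := hNs
      _ ≤ 2 * K ^ (8 * D' + 5) * (2 * (K ^ (8 * D') * A'.card)) := by
        gcongr
        linarith
      _ = 4 * K ^ (16 * D' + 5) * A'.card := by ring
      _ ≤ K * K ^ (16 * D' + 5) * A'.card := by
        gcongr
        linarith
      _ = K ^ (16 * D' + 6) * A'.card := by ring
      _ ≤ K ^ (16 * D' + 8) * A'.card := by
        gcongr ?_ * _
        exact pow_le_pow_right₀ hK1 (by omega)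
      _ = _ := by push_cast; ring
  · intro l hl
    have h1 : T.arcs (B l) ((Finset.range l).biUnion B) ⊆ T.back r A₁ := by
      rintro ⟨v, w⟩ he
      obtain ⟨⟨hv, hw⟩, ha⟩ := mem_arcs.1 he
      obtain ⟨j, hj, hw⟩ := Finset.mem_biUnion.1 hw
      rw [Finset.mem_range] at hj
      exact mem_back.2 ⟨⟨(hB l hl).1 hv, (hB j (hj.trans hl)).1 hw⟩, hBr l hl j hj w hw v hv, ha⟩
    have h2 : ((T.arcs (B l) ((Finset.range l).biUnion B)).card : ℝ) ≤ (T.back r A₁).card := by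
      exact_mod_cast Finset.card_le_card h1
    have h3 : (32 * ((k : ℝ) + 1)) ≤ K := by exact_mod_cast hK
    have h4 : ((T.back r A₁).card : ℝ) * K ^ 2 ≤ s ^ 2 := by
      rw [hA₁c] at hback
      push_cast at hback
      rw [← div_eq_inv_mul, le_div_iff₀ (by positivity)] at hback
      refine le_of_mul_le_mul_right ?_ (by positivity : (0 : ℝ) < K ^ 2)
      linarith
    calc _ ≤ (K : ℝ) * K * (T.back r A₁).card := by gcongr
      _ ≤ _ := by linarith
  · rw [inv_mul_le_iff₀ (by positivity), ← mul_div_assoc, le_div_iff₀ (by positivity)]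
    calc (S.card : ℝ) * (4 * K) ≤ 2 * K ^ (8 * D' + 5) * s * (4 * K) := by gcongr
      _ = 8 * K ^ (8 * D' + 6) * s := by ring
      _ ≤ K * K ^ (8 * D' + 6) * s := by
        gcongr
        linarith
      _ = _ := by ring
  · set c := 8 * D' + 7 with hc
    have h1 : ((K : ℝ) ^ (2 * c + 1))⁻¹ ≤ ((K : ℝ) ^ c)⁻¹ ^ 2 / 4 := by
      rw [inv_pow, ← pow_mul, inv_eq_one_div, inv_eq_one_div, div_div, pow_succ, mul_comm c 2]
      gcongr
      linarith
    have h2 : (K : ℝ) ≤ (3 / 4 * K) ^ 2 := by nlinarith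
    calc (1 : ℝ) = ((K : ℝ) ^ (2 * c + 1)) ^ (k + 2) * (((K : ℝ) ^ (2 * c + 1))⁻¹) ^ (k + 2) := by
          rw [← mul_pow, mul_inv_cancel₀ (by positivity), one_pow]
      _ = (K : ℝ) ^ ((2 * c + 1) * (k + 2)) * (((K : ℝ) ^ (2 * c + 1))⁻¹) ^ (k + 2) := by rw [pow_mul]
      _ ≤ ((3 / 4 * K) ^ 2) ^ ((2 * c + 1) * (k + 2)) *
          (((K : ℝ) ^ c)⁻¹ ^ 2 / 4) ^ (k + 2) := by gcongr
      _ = (3 / 4 * K) ^ ((4 * c + 2) * (k + 2)) * (((K : ℝ) ^ c)⁻¹ ^ 2 / 4) ^ (k + 2) := by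
        rw [← pow_mul]
        congr 2
        ring
      _ ≤ _ := by
        gcongr
        linarith
  · set c := 8 * D' + 7 with hc
    have hzi : z ≤ ((K : ℝ) ^ 4)⁻¹ := by
      rw [inv_eq_one_div, le_div_iff₀ (by positivity)]
      exact hzK.le
    obtain ⟨d, rfl⟩ : ∃ d, D = d + 1 := ⟨D - 1, by omega⟩
    have h1 : 64 * z ^ d ≤ ((K : ℝ) ^ c)⁻¹ ^ (k + 4) := by
      calc 64 * z ^ d ≤ K ^ 2 * (((K : ℝ) ^ 4)⁻¹) ^ d := by gcongr; nlinarith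
        _ = K ^ 2 / K ^ (4 * d) := by rw [inv_pow, ← pow_mul, div_eq_mul_inv]
        _ ≤ 1 / K ^ (c * (k + 4)) := by
          rw [div_le_div_iff₀ (by positivity) (by positivity), one_mul, ← pow_add]
          exact pow_le_pow_right₀ hK1 (by nlinarith)
        _ = _ := by rw [inv_pow, ← pow_mul, one_div]
    calc 64 * z ^ (d + 1) = z * (64 * z ^ d) := by ring
      _ ≤ _ := by gcongr

set_option maxHeartbeats 400000 in
/-- A first sparse set, of constant sparsity and linear size, unless `S` has a large `z`-sparse
subset. -/
lemma exists_first_sparse (p : ℕ → ℕ) {k : ℕ} (hp : p (k + 1) < k + 1) (D' : ℕ) :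
    ∃ K D₀ : ℕ, 32 * (k + 1) ≤ K ∧ ∀ D ≥ D₀, ∀ (n : ℕ) (T : Tournament n) (S : Finset (Fin n))
      (z : ℝ), 0 < z → z ≤ 1 / 2 →
      (∀ U : Finset (Fin n), ∀ z : ℝ, 0 < z → z ≤ 1 →
        ((T.emb p (k + 1) U).card : ℝ) < z ^ D' * (U.card : ℝ) ^ (k + 1) →
        ∃ U' ⊆ U, z ^ D' * U.card ≤ (U'.card : ℝ) ∧ T.Sparse z U') →
      1 < z ^ D * S.card →
      ((T.emb p (k + 2) S).card : ℝ) < z ^ D * (S.card : ℝ) ^ (k + 2) →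
      T.SparseBelow p (k + 2) D S →
      (∃ A ⊆ S, T.Sparse ((K : ℝ) ^ 4)⁻¹ A ∧ (S.card : ℝ) ≤ K ^ (8 * D' + 4) * A.card) ∨
      ∃ S' ⊆ S, z ^ D * S.card ≤ (S'.card : ℝ) ∧ T.Sparse z S' := by
  classical
  obtain ⟨c, hc, φ, hφ, hcopies⟩ := exists_many_copies p
    (lam := 1 / (64 * ((k : ℝ) + 1))) (by positivity) (k + 2) (1 / (2 * ((k : ℝ) + 2)))
    (by positivity)
  obtain ⟨K₁, hK₁⟩ := exists_nat_ge (2 / c)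
  set K := max (32 * (k + 1)) K₁ with hK
  have hK32 : 32 * (k + 1) ≤ K := le_max_left _ _
  have hKr : (32 : ℝ) ≤ K := by exact_mod_cast (by omega : 32 ≤ K)
  have hKpos : (0 : ℝ) < K := by linarith
  have hK1 : (1 : ℝ) ≤ K := by linarith
  have hcK : 2 / K ≤ c := by
    have h1 : (K₁ : ℝ) ≤ K := by exact_mod_cast le_max_right _ _
    rw [div_le_iff₀ hc] at hK₁
    rw [div_le_iff₀ hKpos]
    nlinarith
  set β : ℝ := ((K : ℝ) ^ (4 * D' + 2))⁻¹ with hβ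
  have hβpos : 0 < β := by positivity
  obtain ⟨D₁, hD₁⟩ := pow_unbounded_of_one_lt (((β ^ 2 / 4) ^ (k + 2))⁻¹)
    (by norm_num : (1 : ℝ) < 3 / 2)
  obtain ⟨D₂, hD₂⟩ := exists_pow_lt_of_lt_one (by positivity : 0 < β ^ (k + 4) / 64)
    (by norm_num : (1 / 2 : ℝ) < 1)
  obtain ⟨D₃, hD₃⟩ := exists_pow_lt_of_lt_one hφ (by norm_num : (1 / 2 : ℝ) < 1)
  refine ⟨K, D₁ + (D₂ + 1) + D₃ + (k + 2), hK32,
    fun D hD n T S z hz hz2 hV hN hfew ih => ?_⟩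
  have hNpos : (0 : ℝ) < S.card := by
    by_contra! hcon
    have := mul_nonpos_of_nonneg_of_nonpos (pow_pos hz D).le hcon
    linarith
  have hzD : z ^ D ≤ (1 / 2) ^ D := pow_le_pow_left₀ hz.le hz2 D
  have hNk : k + 2 ≤ S.card := by
    have h1 : (2 : ℝ) ^ D ≤ S.card := by
      have h2 : 1 ≤ (1 / 2 : ℝ) ^ D * S.card := hN.le.trans (by gcongr)
      rw [one_div, inv_pow, ← div_eq_inv_mul, le_div_iff₀ (by positivity)] at h2
      linarith
    have h3 : (2 : ℕ) ^ D ≤ S.card := by exact_mod_cast h1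
    have h4 := (Nat.lt_two_pow_self (n := D)).le
    omega
  obtain ⟨A, hA, B, hB, hAB, hAc, hBc, hABc⟩ : ∃ A ⊆ S, ∃ B ⊆ S, Disjoint A B ∧
      c * S.card ≤ A.card ∧ c * S.card ≤ B.card ∧
      ((T.arcs A B).card : ℝ) ≤ 1 / (64 * ((k : ℝ) + 1)) * A.card * B.card := by
    by_contra! hcon
    obtain ⟨V, hVS, hVr⟩ := exists_intervals (S := S) (r := Fin.val) (Fin.val_injective.injOn)
      (k + 2) (S.card / (k + 2)) (Nat.mul_div_le _ _)
    have h1 := hcopies n T S S.card V hNpos (fun i hi => (hVS i hi).1) (fun i hi => by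
      rw [(hVS i hi).2, one_div_mul_eq_div, div_le_iff₀ (by positivity)]
      have h2 : S.card < (k + 2) * (S.card / (k + 2) + 1) := Nat.lt_mul_div_succ _ (by omega)
      have h3 : 1 ≤ S.card / (k + 2) := Nat.div_pos hNk (by omega)
      have h4 : S.card ≤ (S.card / (k + 2)) * (2 * (k + 2)) := by nlinarith
      exact_mod_cast h4)
      (fun l hl j hj => Finset.disjoint_left.2 fun a ha hb =>
        lt_irrefl _ (hVr l hl j hj a ha a hb)) hcon
    have h2 : T.embIn p (k + 2) V ⊆ T.emb p (k + 2) S := fun f hf => by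
      rw [mem_embIn] at hf
      exact mem_emb.2 ⟨hf.1, fun i => (hVS i i.2).1 (hf.2 i)⟩
    have h3 : ((T.embIn p (k + 2) V).card : ℝ) ≤ (T.emb p (k + 2) S).card := by
      exact_mod_cast Finset.card_le_card h2
    have h4 : z ^ D ≤ φ := hzD.trans
      ((pow_le_pow_of_le_one (by norm_num) (by norm_num) (by omega)).trans hD₃.le)
    have h5 : z ^ D * (S.card : ℝ) ^ (k + 2) ≤ φ * (S.card : ℝ) ^ (k + 2) := by gcongr
    linarith
  obtain ⟨s, hs⟩ : ∃ s, s = ⌈2 / (K : ℝ) * S.card⌉₊ := ⟨_, rfl⟩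
  have hs0 : 0 < s := hs ▸ Nat.ceil_pos.2 (by positivity)
  have hNs : (S.card : ℝ) ≤ K / 2 * s := by
    have h1 : 2 / (K : ℝ) * S.card ≤ s := hs ▸ Nat.le_ceil _
    rw [div_mul_eq_mul_div, div_le_iff₀ hKpos] at h1
    linarith
  have hcN : 2 / (K : ℝ) * S.card ≤ c * S.card := by gcongr
  obtain ⟨A', hA', B', hB', hA's, hB's, harcs⟩ := exists_subsets_arcs_le (s := s) hs0
    (hs ▸ Nat.ceil_le.2 (hcN.trans hAc)) (hs ▸ Nat.ceil_le.2 (hcN.trans hBc)) hABc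
  have key := exists_few_copies_or_sparse (T := T) (S := S) (D := D) (s := s) (K := 2) hp
    hβpos (inv_le_one_of_one_le₀ (one_le_pow₀ hK1)) hz le_rfl (by push_cast; linarith)
    (fun j => if j = 0 then B' else A') ?_ ?_ hs0 ?_ ?_ ?_ hfew ih ?_ ?_
  · refine key.imp_left ?_
    rintro ⟨U, hU, hUs, hUe⟩
    obtain ⟨A₁, hA₁, hA₁c, hA₁s⟩ := hV U ((K : ℝ) ^ 4)⁻¹ (by positivity)
      (inv_le_one_of_one_le₀ (one_le_pow₀ hK1)) (hUe.trans_le (by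
        gcongr
        rw [inv_pow, ← pow_mul]
        exact inv_anti₀ (by positivity) (pow_le_pow_right₀ hK1 (by omega))))
    refine ⟨A₁, hA₁.trans hU, hA₁s, ?_⟩
    rw [inv_pow, inv_mul_le_iff₀ (by positivity), ← pow_mul] at hA₁c
    calc (S.card : ℝ) ≤ K / 2 * s := hNs
      _ ≤ K * (K ^ (4 * D') * A₁.card) := by nlinarith
      _ = K ^ (4 * D' + 1) * A₁.card := by ring
      _ ≤ _ := by
        gcongr ?_ * _
        exact pow_le_pow_right₀ hK1 (by omega)
  · intro j _
    split_ifs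
    · exact hB'.trans hB
    · exact hA'.trans hA
  · intro j _
    split_ifs
    · exact hB's
    · exact hA's
  · intro l hl j hj
    obtain rfl : j = 0 := by omega
    have : l ≠ 0 := by omega
    simp only [this, if_true, if_false]
    exact (hAB.mono hA' hB').symm
  · intro l hl
    interval_cases l
    · simp [arcs]
    · have : (Finset.range 1).biUnion (fun j => if j = 0 then B' else A') = B' := by simp
      rw [this]
      simp only [one_ne_zero, if_false]
      rw [one_div_mul_eq_div, le_div_iff₀ (by positivity)] at harcs
      push_cast
      linarith
  · rw [hβ, inv_mul_le_iff₀ (by positivity), ← mul_div_assoc, le_div_iff₀ (by norm_num)]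
    have h1 : (K : ℝ) ^ 2 ≤ K ^ (4 * D' + 2) := pow_le_pow_right₀ hK1 (by omega)
    have h2 : (K : ℝ) ^ 2 * s ≤ K ^ (4 * D' + 2) * s := by gcongr
    push_cast
    nlinarith
  · have h1 : (3 / 2 : ℝ) ^ D₁ ≤ (3 / 4 * ((2 : ℕ) : ℝ)) ^ D := by
      have : (3 / 4 * ((2 : ℕ) : ℝ)) = 3 / 2 := by norm_num
      rw [this]
      exact pow_le_pow_right₀ (by norm_num) (by omega)
    have h2 := hD₁.le.trans h1
    rwa [inv_le_iff_one_le_mul₀ (by positivity)] at h2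
  · obtain ⟨d, rfl⟩ : ∃ d, D = d + 1 := ⟨D - 1, by omega⟩
    have h1 : z ^ d ≤ β ^ (k + 4) / 64 :=
      (pow_le_pow_left₀ hz.le hz2 d).trans
        ((pow_le_pow_of_le_one (by norm_num) (by norm_num) (by omega)).trans hD₂.le)
    calc 64 * z ^ (d + 1) = z * (64 * z ^ d) := by ring
      _ ≤ _ := mul_le_mul_of_nonneg_left (by linarith) hz.le

lemma sparse_half : T.Sparse (1 / 2) S := by
  classical
  refine ⟨Fin.val, Fin.val_injective.injOn, ?_⟩
  have h1 : Disjoint (T.back Fin.val S) ((T.back Fin.val S).image Prod.swap) := by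
    rw [Finset.disjoint_left]
    intro e he he'
    obtain ⟨e', h1, rfl⟩ := Finset.mem_image.1 he'
    exact lt_asymm (mem_back.1 he).2.1 (mem_back.1 h1).2.1
  have h2 : T.back Fin.val S ∪ (T.back Fin.val S).image Prod.swap ⊆ S ×ˢ S := by
    intro e he
    rw [Finset.mem_product]
    rcases Finset.mem_union.1 he with he | he
    · exact (mem_back.1 he).1
    · obtain ⟨e', h1, rfl⟩ := Finset.mem_image.1 he
      exact (mem_back.1 h1).1.symm
  have h3 := Finset.card_le_card h2
  rw [Finset.card_union_of_disjoint h1, Finset.card_image_of_injective _ Prod.swap_injective,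
    Finset.card_product] at h3
  have h4 : ((T.back Fin.val S).card : ℝ) + (T.back Fin.val S).card ≤ S.card * S.card := by
    exact_mod_cast h3
  linarith

/-- In every tournament, a set with few copies of the pattern contains a large sparse subset. -/
theorem exists_sparse_of_few_copies (p : ℕ → ℕ) (hp : ∀ i, 1 ≤ i → p i < i) (k : ℕ) :
    ∃ D : ℕ, ∀ (n : ℕ) (T : Tournament n) (S : Finset (Fin n)) (z : ℝ), 0 < z → z ≤ 1 →
      ((T.emb p (k + 1) S).card : ℝ) < z ^ D * (S.card : ℝ) ^ (k + 1) →
      ∃ S' ⊆ S, z ^ D * S.card ≤ (S'.card : ℝ) ∧ T.Sparse z S' := by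
  classical
  induction k with
  | zero =>
    refine ⟨0, fun n T S z _ _ hlt => absurd hlt (not_lt.2 ?_)⟩
    have : S.card ≤ (T.emb p 1 S).card := by
      refine Finset.card_le_card_of_injOn (fun v _ => v) ?_ ?_
      · intro v hv
        exact mem_emb.2 ⟨fun i j hij => absurd hij (by omega), fun _ => hv⟩
      · exact fun v _ w _ hvw => congrFun hvw 0
    simpa using this
  | succ k ih =>
    obtain ⟨D', hV⟩ := ih
    obtain ⟨K₀, D₀, hK₀, hfirst⟩ := exists_first_sparse p (hp (k + 1) (by omega)) D'
    have hK₀r : (1 : ℝ) ≤ K₀ := by exact_mod_cast (by omega : 1 ≤ K₀)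
    obtain ⟨D₁, hD₁⟩ := exists_pow_lt_of_lt_one
      (by positivity : (0 : ℝ) < ((K₀ : ℝ) ^ (8 * D' + 4))⁻¹) (by norm_num : (1 / 2 : ℝ) < 1)
    set D := D₀ + D₁ + (4 * (8 * D' + 7) + 2) * (k + 2) with hD
    refine ⟨D, fun n T S => ?_⟩
    induction hm : S.card using Nat.strong_induction_on generalizing S with
    | _ m ihm =>
    subst hm
    intro z hz hz1 hfew
    have hzD1 : z ^ D ≤ 1 := pow_le_one₀ hz.le hz1
    by_cases hz2 : 1 / 2 < z
    · exact ⟨S, subset_rfl, mul_le_of_le_one_left (Nat.cast_nonneg _) hzD1,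
        sparse_half.mono hz2.le⟩
    by_cases hN : z ^ D * S.card ≤ 1
    · rcases S.eq_empty_or_nonempty with rfl | ⟨v, hv⟩
      · exact ⟨∅, subset_rfl, by simp, Fin.val, by simp, by simp [back]⟩
      · exact ⟨{v}, by simpa using hv, by simpa using hN, Fin.val, by simp, by
          have h0 : T.back Fin.val {v} = ∅ := by
            rw [Finset.eq_empty_iff_forall_notMem]
            intro e he
            simp only [mem_back, Finset.mem_singleton] at he
            rw [he.1.1, he.1.2] at he
            exact lt_irrefl _ he.2.1
          simp [h0, hz.le]⟩
    rw [not_lt] at hz2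
    rw [not_le] at hN
    have hbelow : T.SparseBelow p (k + 2) D S := fun U hU z hz hz1 hlt =>
      ihm U.card hU U rfl z hz hz1 hlt
    by_contra hgoal
    have hchain : ∀ i : ℕ, ∃ K : ℕ, i ≤ K ∧ 32 * (k + 1) ≤ K ∧ z * K ^ 4 < 1 ∧ ∃ A ⊆ S,
        T.Sparse ((K : ℝ) ^ 4)⁻¹ A ∧ (S.card : ℝ) ≤ K ^ (8 * D' + 4) * A.card := by
      intro i
      induction i with
      | zero =>
        obtain ⟨A, hA, hAs, hAc⟩ := (hfirst D (by omega) n T S z hz hz2 (hV n T) hN hfew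
          hbelow).resolve_right hgoal
        refine ⟨K₀, Nat.zero_le _, hK₀, ?_, A, hA, hAs, hAc⟩
        by_contra! hcon
        refine hgoal ⟨A, hA, ?_, hAs.mono ?_⟩
        · calc z ^ D * S.card ≤ ((K₀ : ℝ) ^ (8 * D' + 4))⁻¹ * S.card := by
                gcongr
                refine (pow_le_pow_left₀ hz.le hz2 D).trans
                  ((pow_le_pow_of_le_one (by norm_num) (by norm_num) ?_).trans hD₁.le)
                omega
            _ ≤ A.card := by
                rw [inv_mul_le_iff₀ (by positivity)]
                exact hAc
        · rw [inv_le_iff_one_le_mul₀ (by positivity)]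
          exact hcon
      | succ i ihi =>
        obtain ⟨K, hiK, hK, hzK, A, hA, hAs, hAc⟩ := ihi
        have hKr : (1 : ℝ) ≤ K := by exact_mod_cast (by omega : 1 ≤ K)
        obtain ⟨A', hA', hAs', hAc'⟩ := (exists_sparser (hp (k + 1) (by omega)) hz hK hzK
          (hV n T) (by omega) hN hfew hbelow hA hAs hAc).resolve_right hgoal
        have hK2 : 2 ≤ K := by omega
        have hKK : K + 1 ≤ K ^ 2 := by nlinarith
        have hKpos : (0 : ℝ) < ((K ^ 2 : ℕ) : ℝ) := by
          exact_mod_cast (by positivity : 0 < K ^ 2)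
        refine ⟨K ^ 2, by omega, by omega, ?_, A', hA', hAs', hAc'⟩
        by_contra! hcon
        refine hgoal ⟨A', hA', ?_, hAs'.mono ?_⟩
        · calc z ^ D * S.card
              ≤ z ^ (4 * D' + 2) * (((K ^ 2 : ℕ) : ℝ) ^ (8 * D' + 4) * A'.card) := by
                refine mul_le_mul ?_ hAc' (Nat.cast_nonneg _) (by positivity)
                refine pow_le_pow_of_le_one hz.le hz1 ?_
                nlinarith
            _ = (z * K ^ 4) ^ (4 * D' + 2) * A'.card := by push_cast; ring
            _ ≤ 1 * A'.card := by
                gcongr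
                exact pow_le_one₀ (by positivity) hzK.le
            _ = A'.card := one_mul _
        · rw [inv_le_iff_one_le_mul₀ (by positivity)]
          exact hcon
    obtain ⟨i, hi⟩ := exists_nat_gt (1 / z)
    obtain ⟨K, hiK, hK, hzK, _⟩ := hchain i
    rw [div_lt_iff₀ hz] at hi
    have h1 : (i : ℝ) ≤ K := by exact_mod_cast hiK
    have h2 : (K : ℝ) ≤ K ^ 4 :=
      le_self_pow₀ (by exact_mod_cast (by omega : 1 ≤ K)) (by norm_num)
    nlinarith

/-- A super right nebula is a pattern in which every vertex has at most one parent. -/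
lemma IsSuperRightNebula.exists_pattern {H : Tournament N} (hH : H.IsSuperRightNebula) :
    ∃ p : ℕ → ℕ, (∀ i, 1 ≤ i → p i < i) ∧ ∀ (n : ℕ) (T : Tournament n),
      ¬ T.Contains H → T.emb p (N + 1) Finset.univ = ∅ := by
  classical
  obtain ⟨θ, m, Q, ctr, ⟨-, hdisj, hback⟩, hstar⟩ := hH
  have huniq : ∀ u u' v, H.Backward θ u v → H.Backward θ u' v → u = u' := by
    intro u u' v hu hu'
    obtain ⟨i, hui, hvi⟩ := hback u v hu
    obtain ⟨j, huj, hvj⟩ := hback u' v hu'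
    obtain rfl : i = j := by
      by_contra hij
      exact Finset.disjoint_left.1 (hdisj i j hij) hvi hvj
    rw [(hstar i).2.2.2 u hui v hvi hu, (hstar i).2.2.2 u' huj v hvi hu']
  let idx : Fin N → ℕ := fun v => N - pos θ v
  have hidx : ∀ v, 0 < idx v ∧ idx v < N + 1 := fun v => by
    have := (pos θ v).isLt
    simp only [idx]
    omega
  have hlt : ∀ u v, idx u < idx v ↔ pos θ v < pos θ u := fun u v => by
    have := (pos θ u).isLt
    have := (pos θ v).isLt
    simp only [idx, Fin.lt_def]
    omega
  have hinj : Function.Injective idx := fun u v huv => by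
    have h1 : ¬ pos θ v < pos θ u := fun h => huv.not_lt ((hlt u v).2 h)
    have h2 : ¬ pos θ u < pos θ v := fun h => huv.symm.not_lt ((hlt v u).2 h)
    exact θ.symm.injective (le_antisymm (not_lt.1 h1) (not_lt.1 h2))
  let R : ℕ → ℕ → Prop := fun i j => ∃ u v, idx u = j ∧ idx v = i ∧ H.Backward θ u v
  let p : ℕ → ℕ := fun i => if hi : ∃ j, R i j then hi.choose else 0
  have hp : ∀ u v, idx u = p (idx v) ↔ H.Backward θ u v := by
    intro u v
    by_cases hv : ∃ j, R (idx v) j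
    · have hpv : p (idx v) = hv.choose := dif_pos hv
      obtain ⟨u', v', hu', hv', hb⟩ := hv.choose_spec
      obtain rfl := hinj hv'
      rw [hpv, ← hu']
      exact ⟨fun h => hinj h ▸ hb, fun h => congrArg idx (huniq _ _ _ h hb)⟩
    · have hpv : p (idx v) = 0 := dif_neg hv
      rw [hpv]
      exact ⟨fun h => absurd h (hidx u).1.ne', fun h => absurd ⟨_, u, v, rfl, rfl, h⟩ hv⟩
  refine ⟨p, fun i hi => ?_, fun n T hT => ?_⟩
  · by_cases hv : ∃ j, R i j
    · have hpv : p i = hv.choose := dif_pos hv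
      obtain ⟨u, v, hu, rfl, hb⟩ := hv.choose_spec
      rw [hpv, ← hu, hlt]
      exact hb.2
    · have hpv : p i = 0 := dif_neg hv
      omega
  · rw [Finset.eq_empty_iff_forall_notMem]
    intro f hf
    have hf' := (mem_emb.1 hf).1
    let e : Fin N → Fin n := fun v => f ⟨idx v, (hidx v).2⟩
    have hadj : ∀ u v, H.adj u v → T.adj (e u) (e v) := by
      intro u v huv
      have hne : idx u ≠ idx v := fun h => H.adj_irrefl v (hinj h ▸ huv)
      rcases hne.lt_or_gt with h | h
      · exact (hf' ⟨idx v, (hidx v).2⟩ ⟨idx u, (hidx u).2⟩ h).1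
          ((hp u v).2 ⟨huv, (hlt u v).1 h⟩)
      · exact (hf' ⟨idx u, (hidx u).2⟩ ⟨idx v, (hidx v).2⟩ h).2
          fun h' => H.asymm u v huv ((hp v u).1 h').1
    refine hT ⟨⟨e, fun u v huv => ?_⟩, fun u v => ⟨hadj u v, fun huv => ?_⟩⟩
    · by_contra hne
      rcases H.total u v hne with h | h
      · exact T.adj_irrefl (e v) (huv ▸ hadj u v h)
      · exact T.adj_irrefl (e v) (huv ▸ hadj v u h)
    · change T.adj (e u) (e v) at huv
      have hne : u ≠ v := by
        rintro rfl
        exact T.adj_irrefl _ huv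
      exact (H.total u v hne).resolve_right fun h => T.asymm _ _ huv (hadj v u h)

lemma IsTransOn.card_le_trSize (hS : T.IsTransOn S) : S.card ≤ T.trSize := by
  refine le_csSup ⟨n, ?_⟩ ⟨S, Finset.subset_univ S, hS, rfl⟩
  rintro k ⟨t, -, -, rfl⟩
  simpa using Finset.card_le_univ t

lemma isTransOn_pair (a b : Fin n) : T.IsTransOn {a, b} := by
  intro u hu v hv w hw huv hvw
  have h1 : u ≠ v := by
    rintro rfl
    exact T.adj_irrefl _ huv
  have h2 : v ≠ w := by
    rintro rfl
    exact T.adj_irrefl _ hvw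
  have h3 : u = w := by
    simp only [Finset.mem_insert, Finset.mem_singleton] at hu hv hw
    grind
  exact absurd (h3 ▸ hvw) (T.asymm _ _ huv)

/-- A very sparse set contains a transitive set. -/
lemma Sparse.le_trSize (hS : T.Sparse z S) (hz : 0 ≤ z) {t : ℕ} (ht : t ≤ S.card)
    (hzt : z * (t : ℝ) ^ 2 < 1) : t ≤ T.trSize := by
  obtain ⟨S', -, rfl, r, hr, hb⟩ := hS.exists_subset hz ht
  have h0 : T.back r S' = ∅ := by
    rw [← Finset.card_eq_zero, ← Nat.lt_one_iff]
    exact_mod_cast hb.trans_lt hzt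
  have hlt : ∀ u ∈ S', ∀ v ∈ S', T.adj u v → r u < r v := by
    intro u hu v hv huv
    have hne : r u ≠ r v := fun h => T.adj_irrefl v (hr hu hv h ▸ huv)
    refine lt_of_le_of_ne (not_lt.1 fun h => ?_) hne
    have : (u, v) ∈ T.back r S' := mem_back.2 ⟨⟨hu, hv⟩, h, huv⟩
    simp [h0] at this
  refine IsTransOn.card_le_trSize fun u hu v hv w hw huv hvw => ?_
  have h1 := (hlt u hu v hv huv).trans (hlt v hv w hw hvw)
  have hne : u ≠ w := by
    rintro rfl
    exact lt_irrefl _ h1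
  exact (T.total u w hne).resolve_right fun h => lt_asymm h1 (hlt w hw u hu h)

/-- A super right nebula has the Erdős–Hajnal property. -/
theorem IsSuperRightNebula.exists_rpow_le_trSize {H : Tournament N}
    (hH : H.IsSuperRightNebula) :
    ∃ ε : ℝ, 0 < ε ∧ ∀ (n : ℕ) (T : Tournament n),
      ¬ T.Contains H → (n : ℝ) ^ ε ≤ (T.trSize : ℝ) := by
  obtain ⟨p, hp, hfree⟩ := hH.exists_pattern
  obtain ⟨D, hD⟩ := exists_sparse_of_few_copies p hp N
  refine ⟨((5 * D + 2 : ℕ) : ℝ)⁻¹, by positivity, fun n T hT => ?_⟩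
  rcases Nat.eq_zero_or_pos n with rfl | hn
  · rw [Nat.cast_zero, Real.zero_rpow (by positivity)]
    exact Nat.cast_nonneg _
  obtain ⟨x, hx⟩ : ∃ x : ℝ, x = (n : ℝ) ^ (((5 * D + 2 : ℕ) : ℝ)⁻¹) := ⟨_, rfl⟩
  have hxn : x ^ (5 * D + 2) = n :=
    hx ▸ Real.rpow_inv_natCast_pow (Nat.cast_nonneg n) (by omega)
  rw [← hx]
  rcases Nat.eq_or_lt_of_le hn with rfl | hn1
  · rw [hx, Nat.cast_one, Real.one_rpow]
    exact_mod_cast (isTransOn_pair (T := T) 0 0).card_le_trSize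
  by_cases hx2 : x ≤ 2
  · have h1 := (isTransOn_pair (T := T) ⟨0, hn⟩ ⟨1, hn1⟩).card_le_trSize
    rw [Finset.card_pair (by simp)] at h1
    exact hx2.trans (by exact_mod_cast h1)
  rw [not_le] at hx2
  have hxt : x ≤ ⌈x⌉₊ := Nat.le_ceil x
  have htx : (⌈x⌉₊ : ℝ) ≤ x ^ 2 := by
    have := Nat.ceil_lt_add_one (by linarith : 0 ≤ x)
    nlinarith
  set t := ⌈x⌉₊
  have ht2 : (t : ℝ) ^ 2 + 1 ≤ x ^ 5 := by
    have h1 : (t : ℝ) ^ 2 ≤ (x ^ 2) ^ 2 := by gcongr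
    have h2 : 1 ≤ x ^ 4 := one_le_pow₀ (by linarith)
    calc (t : ℝ) ^ 2 + 1 ≤ x ^ 4 + x ^ 4 := by linarith
      _ ≤ x ^ 4 * x := by nlinarith
      _ = x ^ 5 := by ring
  have hz : (0 : ℝ) < ((t : ℝ) ^ 2 + 1)⁻¹ := by positivity
  obtain ⟨S', -, hS', hsp⟩ := hD n T Finset.univ ((t : ℝ) ^ 2 + 1)⁻¹ hz
    (inv_le_one_of_one_le₀ (by nlinarith)) (by
      rw [hfree n T hT, Finset.card_empty, Nat.cast_zero, Finset.card_univ, Fintype.card_fin]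
      positivity)
  refine hxt.trans ?_
  have hcard : t ≤ S'.card := by
    rw [inv_pow, inv_mul_le_iff₀ (by positivity), Finset.card_univ, Fintype.card_fin,
      ← hxn] at hS'
    have h1 : ((t : ℝ) ^ 2 + 1) ^ D ≤ x ^ (5 * D) := by
      rw [pow_mul]
      gcongr
    have h2 : x ^ (5 * D) * x ^ 2 ≤ x ^ (5 * D) * S'.card := by
      rw [← pow_add]
      exact hS'.trans (by gcongr)
    exact_mod_cast htx.trans (le_of_mul_le_mul_left h2 (by positivity))
  exact_mod_cast hsp.le_trSize hz.le hcard (by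
    rw [inv_mul_lt_iff₀ (by positivity)]
    linarith)

end Tournament

theorem stmt7 {n₁ n₂ : ℕ} (H₁ : Tournament n₁) (H₂ : Tournament n₂)
    (h₁ : H₁.IsSuperRightNebula) (h₂ : H₂.IsCLDeltaGalaxy) : EHPair H₁ H₂ := by
  obtain ⟨ε, hε, h⟩ := h₁.exists_rpow_le_trSize
  exact ⟨ε, hε, fun n T hT _ => h n T hT⟩
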